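/- Let Γ be a set of topological lines in ℝ² such that γ \ γ' is a portion of γ for all distinct γ, γ' ∈ Γ; define J(γ,γ') := cl(γ △ γ') and σ ∈ (γ, γ')_Γ iff J(γ, σ) ⊂ cl(Int J(γ, γ')). Then for all distinct σ, σ', σ'' ∈ Γ, exactly one of the three assertions σ ∈ (σ', σ'')_Γ, σ' ∈ (σ, σ'')_Γ, σ'' ∈ (σ, σ')_Γ holds. -/

import Mathlib

abbrev Plane := ℝ × ℝ

/-- A topological line: a subset of the plane homeomorphic to `ℝ`. -/
def IsTopLine (γ : Set Plane) : Prop := Nonempty (ℝ ≃ₜ γ)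

/-- A portion of a topological line `γ` : a subset whose preimage under any
parametrizing homeomorphism `ℝ ≃ₜ γ` is a bounded open interval. -/
def IsPortion (γ π : Set Plane) : Prop :=
  π ⊆ γ ∧ ∀ Φ : ℝ ≃ₜ γ, ∃ a b : ℝ, {t : ℝ | (Φ t : Plane) ∈ π} = Set.Ioo a b

/-- A Jordan curve: a subset of the plane homeomorphic to the circle. -/
def IsJordanCurve (J : Set Plane) : Prop := Nonempty (Circle ≃ₜ J)

/-- Interior region of a Jordan curve. -/
def intRegion (J : Set Plane) : Set Plane :=
  {z | z ∉ J ∧ Bornology.IsBounded (connectedComponentIn Jᶜ z)}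

/-- Exterior region of a Jordan curve. -/
def extRegion (J : Set Plane) : Set Plane :=
  {z | z ∉ J ∧ ¬ Bornology.IsBounded (connectedComponentIn Jᶜ z)}

/-- The Jordan curve associated with two topological lines. -/
noncomputable def lineJ (γ γ' : Set Plane) : Set Plane := closure (symmDiff γ γ')

/-- The betweenness relation: `σ` lies between `γ` and `γ'`. -/
def Between (γ γ' σ : Set Plane) : Prop :=
  lineJ γ σ ⊆ closure (intRegion (lineJ γ γ'))

open Set Topology

/-- `f` has a continuous logarithm on `S`. -/
def HasLogOn {X : Type*} [TopologicalSpace X] (f : X → ℂ) (S : Set X) : Prop :=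
  ∃ g : X → ℂ, ContinuousOn g S ∧ ∀ x ∈ S, Complex.exp (g x) = f x

namespace HasLogOn

variable {X : Type*} [TopologicalSpace X] {f f' : X → ℂ} {S T : Set X}

theorem mono (h : HasLogOn f S) (hT : T ⊆ S) : HasLogOn f T :=
  let ⟨g, hg, hgf⟩ := h
  ⟨g, hg.mono hT, fun x hx => hgf x (hT hx)⟩

theorem congr (h : HasLogOn f S) (hf : ∀ x ∈ S, f x = f' x) : HasLogOn f' S :=
  let ⟨g, hg, hgf⟩ := h
  ⟨g, hg, fun x hx => (hgf x hx).trans (hf x hx)⟩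

theorem mul (h : HasLogOn f S) (h' : HasLogOn f' S) : HasLogOn (fun x => f x * f' x) S :=
  let ⟨g, hg, hgf⟩ := h
  let ⟨g', hg', hgf'⟩ := h'
  ⟨fun x => g x + g' x, hg.add hg', fun x hx => by rw [Complex.exp_add, hgf x hx, hgf' x hx]⟩

theorem const {c : ℂ} (hc : c ≠ 0) (S : Set X) : HasLogOn (fun _ => c) S :=
  ⟨fun _ => Complex.log c, continuousOn_const, fun _ _ => Complex.exp_log hc⟩

/-- The homotopy lifting property for the exponential. -/
theorem of_homotopy {H : unitInterval × X → ℂ} (hH : ContinuousOn H (univ ×ˢ S))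
    (hne : ∀ t, ∀ x ∈ S, H (t, x) ≠ 0) (h0 : HasLogOn (fun x => H (0, x)) S) :
    HasLogOn (fun x => H (1, x)) S := by
  classical
  obtain ⟨g, hg, hgf⟩ := h0
  let H' : C(unitInterval × S, {z : ℂ // z ≠ 0}) :=
    ⟨fun p => ⟨H (p.1, p.2), hne p.1 p.2 p.2.2⟩,
      Continuous.subtype_mk (hH.comp_continuous (f := fun p : unitInterval × S => (p.1, (p.2 : X)))
        (by fun_prop) (fun p => ⟨mem_univ _, p.2.2⟩)) _⟩
  let g' : C(S, ℂ) := ⟨fun x => g x, hg.domRestrict⟩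
  have h0' : ∀ a, H' (0, a) = ⟨Complex.exp (g' a), Complex.exp_ne_zero _⟩ := fun a =>
    Subtype.ext (hgf a a.2).symm
  let G := Complex.isCoveringMap_exp.liftHomotopy H' g' h0'
  have hG := Complex.isCoveringMap_exp.liftHomotopy_lifts H' g' h0'
  refine ⟨fun x => if hx : x ∈ S then G (1, ⟨x, hx⟩) else 0, ?_, fun x hx => ?_⟩
  · rw [continuousOn_iff_continuous_domRestrict]
    have : S.domRestrict (fun x => if hx : x ∈ S then G (1, ⟨x, hx⟩) else 0)
        = fun x : S => G (1, x) := by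
      ext x; simp [Set.domRestrict]
    rw [this]
    fun_prop
  · simp only [dif_pos hx]
    exact congrArg Subtype.val (congr_fun hG (1, ⟨x, hx⟩))

end HasLogOn

/-- Two continuous logarithms of a function on a preconnected set differ by a constant. -/
theorem sub_eq_sub_of_exp_eq {X : Type*} [TopologicalSpace X] {g g' : X → ℂ} {S : Set X}
    (hS : IsPreconnected S) (hg : ContinuousOn g S) (hg' : ContinuousOn g' S)
    (h : ∀ x ∈ S, Complex.exp (g x) = Complex.exp (g' x)) {x y : X} (hx : x ∈ S) (hy : y ∈ S) :
    g x - g' x = g y - g' y := by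
  have hc : Complex.exp (g x - g' x) = 1 := by
    rw [Complex.exp_sub, h x hx, div_self (Complex.exp_ne_zero _)]
  have key := Complex.isCoveringMap_exp.eqOn_of_comp_eqOn hS hg
    (hg'.add (continuousOn_const (c := g x - g' x))) (fun z hz => Subtype.ext (by
      simp [Complex.exp_add, hc, h z hz])) hx (by simp)
  have := key hy
  rw [this]; simp

theorem HasLogOn.exists_eqOn_inter {X : Type*} [TopologicalSpace X] {f : X → ℂ} {S T : Set X}
    (hS : HasLogOn f S) (hT : HasLogOn f T) (hST : IsPreconnected (S ∩ T)) :
    ∃ g : X → ℂ, ContinuousOn g S ∧ ContinuousOn g T ∧ ∀ x ∈ S ∪ T, Complex.exp (g x) = f x := by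
  classical
  obtain ⟨g, hg, hgf⟩ := hS
  obtain ⟨g', hg', hgf'⟩ := hT
  obtain ⟨c, hc, hgg'⟩ : ∃ c : ℂ, Complex.exp c = 1 ∧ ∀ x ∈ S ∩ T, g x = g' x + c := by
    rcases (S ∩ T).eq_empty_or_nonempty with h | ⟨y, hy⟩
    · exact ⟨0, by simp, by simp [h]⟩
    · refine ⟨g y - g' y, ?_, fun x hx => ?_⟩
      · rw [Complex.exp_sub, hgf y hy.1, hgf' y hy.2, div_self]
        rw [← hgf y hy.1]; exact Complex.exp_ne_zero _
      · rw [← sub_eq_sub_of_exp_eq hST (hg.mono inter_subset_left) (hg'.mono inter_subset_right)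
          (fun z hz => (hgf z hz.1).trans (hgf' z hz.2).symm) hx hy]
        ring
  have hT' : ∀ x ∈ T, (if x ∈ S then g x else g' x + c) = g' x + c := fun x hx => by
    split_ifs with h
    · exact hgg' x ⟨h, hx⟩
    · rfl
  refine ⟨fun x => if x ∈ S then g x else g' x + c, hg.congr fun x hx => if_pos hx,
    (hg'.add continuousOn_const).congr hT', fun x hx => ?_⟩
  by_cases h : x ∈ S
  · simp only [if_pos h, hgf x h]
  · have hxT : x ∈ T := hx.resolve_left h
    simp only [if_neg h, Complex.exp_add, hc, mul_one, hgf' x hxT]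

theorem HasLogOn.union_of_isClosed {X : Type*} [TopologicalSpace X] {f : X → ℂ} {S T : Set X}
    (hS : HasLogOn f S) (hT : HasLogOn f T) (hST : IsPreconnected (S ∩ T)) (hSc : IsClosed S)
    (hTc : IsClosed T) : HasLogOn f (S ∪ T) :=
  let ⟨g, hgS, hgT, hg⟩ := hS.exists_eqOn_inter hT hST
  ⟨g, hgS.union_of_isClosed hgT hSc hTc, hg⟩

theorem HasLogOn.union_of_isOpen {X : Type*} [TopologicalSpace X] {f : X → ℂ} {S T : Set X}
    (hS : HasLogOn f S) (hT : HasLogOn f T) (hST : IsPreconnected (S ∩ T)) (hSo : IsOpen S)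
    (hTo : IsOpen T) : HasLogOn f (S ∪ T) :=
  let ⟨g, hgS, hgT, hg⟩ := hS.exists_eqOn_inter hT hST
  ⟨g, hgS.union_of_isOpen hgT hSo hTo, hg⟩

/-- A nowhere vanishing continuous function on the plane has a logarithm. -/
theorem hasLogOn_univ {f : Plane → ℂ} (hf : Continuous f) (hne : ∀ z, f z ≠ 0) :
    HasLogOn f univ := by
  have := HasLogOn.of_homotopy (H := fun p : unitInterval × Plane => f ((p.1 : ℝ) • p.2))
    (S := univ)
    (by fun_prop) (fun t x _ => hne _) (by simpa using HasLogOn.const (hne 0) univ)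
  simpa using this

/-- A nowhere vanishing continuous function on an arc has a logarithm. -/
theorem hasLogOn_arc {φ : ℝ → Plane} (hφ : Continuous φ) (hinj : φ.Injective) (s t : ℝ)
    {f : Plane → ℂ} (hf : ContinuousOn f (φ '' Icc s t)) (hne : ∀ z ∈ φ '' Icc s t, f z ≠ 0) :
    HasLogOn f (φ '' Icc s t) := by
  rcases lt_or_ge t s with hst | hst
  · simp only [Icc_eq_empty (not_le.2 hst), image_empty]
    exact ⟨fun _ => 0, continuousOn_const, by simp⟩
  have hmem : ∀ u : unitInterval, ∀ x ∈ Icc s t, φ (s + u * (x - s)) ∈ φ '' Icc s t := by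
    intro u x hx
    refine mem_image_of_mem _ ⟨?_, ?_⟩
    · nlinarith [u.2.1, hx.1]
    · nlinarith [u.2.2, hx.1, hx.2]
  have h := HasLogOn.of_homotopy (H := fun p : unitInterval × ℝ => f (φ (s + p.1 * (p.2 - s))))
    (S := Icc s t) (hf.comp (by fun_prop) (fun p hp => hmem p.1 p.2 hp.2))
    (fun u x hx => hne _ (hmem u x hx))
    (by simpa using HasLogOn.const (hne _ ⟨s, ⟨le_rfl, hst⟩, rfl⟩) _)
  obtain ⟨g, hg, hgf⟩ := h
  have he : IsClosedEmbedding (fun x : Icc s t => φ x) :=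
    (hφ.comp continuous_subtype_val).isClosedEmbedding
      (hinj.comp Subtype.val_injective)
  obtain ⟨G, hG⟩ := ContinuousMap.exists_extension' he ⟨fun x => g x, hg.domRestrict⟩
  refine ⟨G, G.continuous.continuousOn, ?_⟩
  rintro _ ⟨x, hx, rfl⟩
  have h1 : G (φ x) = g x := congr_fun hG ⟨x, hx⟩
  rw [h1, hgf x hx]
  simp

/-- The identification of the plane with the complex numbers. -/
noncomputable def planeToComplex : Plane ≃L[ℝ] ℂ := Complex.equivRealProdCLM.symm

theorem planeToComplex_sub_ne_zero {z a : Plane} (h : z ≠ a) : planeToComplex (z - a) ≠ 0 := by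
  simpa [sub_eq_zero] using h

/-- If the path `γ` avoids `S`, then `(z - γ 0) / (z - γ 1)` has a logarithm on `S`. -/
theorem hasLogOn_div_of_path {a b : Plane} (γ : Path a b) {S : Set Plane}
    (hS : ∀ t, γ t ∉ S) :
    HasLogOn (fun z => planeToComplex (z - a) / planeToComplex (z - b)) S := by
  have hne : ∀ t, ∀ x ∈ S, planeToComplex (x - γ t) ≠ 0 := fun t x hx =>
    planeToComplex_sub_ne_zero fun h => hS t (h ▸ hx)
  have hne0 : ∀ x ∈ S, planeToComplex (x - a) ≠ 0 := fun x hx => by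
    simpa using hne 0 x hx
  have := HasLogOn.of_homotopy
    (H := fun p : unitInterval × Plane =>
      planeToComplex (p.2 - a) / planeToComplex (p.2 - γ p.1)) (S := S)
    (ContinuousOn.div (by fun_prop) (by fun_prop) fun p hp => hne p.1 p.2 hp.2)
    (fun t x hx => div_ne_zero (hne0 x hx) (hne t x hx))
    ((HasLogOn.const one_ne_zero S).congr fun x hx => by
      simp only [γ.source, div_self (hne0 x hx)])
  simpa using this

/-- The function `z - a` has no logarithm on a circle around `a`. -/
theorem not_hasLogOn_circle (a : Plane) {r : ℝ} (hr : 0 < r) :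
    ¬ HasLogOn (fun z => planeToComplex (z - a)) {z | ‖planeToComplex (z - a)‖ = r} := by
  rintro ⟨g, hg, hgf⟩
  let c : ℝ → Plane := fun θ => planeToComplex.symm (r * Complex.exp (θ * Complex.I)) + a
  have hc : Continuous c := by fun_prop
  have hc' : ∀ θ, planeToComplex (c θ - a) = r * Complex.exp (θ * Complex.I) := by
    intro θ; simp [c]
  have hcm : ∀ θ, c θ ∈ {z | ‖planeToComplex (z - a)‖ = r} := by
    intro θ
    rw [mem_ofPred_eq, hc', norm_mul, Complex.norm_exp_ofReal_mul_I]
    simp [abs_of_pos hr]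
  have hrc : (r : ℂ) ≠ 0 := by exact_mod_cast hr.ne'
  have := sub_eq_sub_of_exp_eq (X := ℝ) (S := univ) isPreconnected_univ
    (g := fun θ => g (c θ)) (g' := fun θ => Complex.log r + θ * Complex.I)
    (hg.comp_continuous hc hcm).continuousOn (by fun_prop)
    (fun θ _ => by
      rw [Complex.exp_add, Complex.exp_log hrc, ← hc' θ]; exact hgf _ (hcm θ))
    (mem_univ 0) (mem_univ (2 * Real.pi))
  have hper : c (2 * Real.pi) = c 0 := by simp [c]
  rw [hper] at this
  simp [Real.pi_ne_zero] at this

section Components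

variable {K : Set Plane} {z a : Plane}

theorem frontier_connectedComponentIn_subset (hK : IsClosed K) :
    frontier (connectedComponentIn Kᶜ a) ⊆ K := by
  intro x hx
  by_contra hxK
  have hU : IsOpen (connectedComponentIn Kᶜ a) := hK.isOpen_compl.connectedComponentIn
  have hV : IsOpen (connectedComponentIn Kᶜ x) := hK.isOpen_compl.connectedComponentIn
  rw [hU.frontier_eq] at hx
  obtain ⟨y, hyx, hya⟩ := mem_closure_iff.1 hx.1 _ hV (mem_connectedComponentIn hxK)
  apply hx.2
  rw [connectedComponentIn_eq hya, ← connectedComponentIn_eq hyx]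
  exact mem_connectedComponentIn hxK

theorem isOpen_extRegion (hK : IsClosed K) : IsOpen (extRegion K) := by
  rw [isOpen_iff_forall_mem_open]
  intro z hz
  refine ⟨connectedComponentIn Kᶜ z, fun y hy => ⟨connectedComponentIn_subset _ _ hy, ?_⟩,
    hK.isOpen_compl.connectedComponentIn, mem_connectedComponentIn hz.1⟩
  rw [← connectedComponentIn_eq hy]
  exact hz.2

theorem disjoint_intRegion_extRegion : Disjoint (intRegion K) (extRegion K) :=
  Set.disjoint_left.2 fun _ h h' => h'.2 h.2

theorem connectedComponentIn_subset_intRegion (h : z ∈ intRegion K) :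
    connectedComponentIn Kᶜ z ⊆ intRegion K := fun _ hy =>
  ⟨connectedComponentIn_subset _ _ hy, connectedComponentIn_eq hy ▸ h.2⟩

theorem connectedComponentIn_subset_extRegion (h : z ∈ extRegion K) :
    connectedComponentIn Kᶜ z ⊆ extRegion K := fun _ hy =>
  ⟨connectedComponentIn_subset _ _ hy, connectedComponentIn_eq hy ▸ h.2⟩

/-- A preconnected set in the complement of `K` is on one side of `K`. -/
theorem subset_intRegion_or_subset_extRegion {D : Set Plane}
    (hD : IsPreconnected D) (hDK : D ⊆ Kᶜ) : D ⊆ intRegion K ∨ D ⊆ extRegion K := by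
  rcases D.eq_empty_or_nonempty with rfl | ⟨x, hx⟩
  · exact Or.inl (empty_subset _)
  have hsub := hD.subset_connectedComponentIn hx hDK
  by_cases h : Bornology.IsBounded (connectedComponentIn Kᶜ x)
  · exact Or.inl (hsub.trans (connectedComponentIn_subset_intRegion ⟨hDK hx, h⟩))
  · exact Or.inr (hsub.trans (connectedComponentIn_subset_extRegion ⟨hDK hx, h⟩))

theorem isPreconnected_setOf_lt_norm {R : ℝ} (hR : 0 ≤ R) :
    IsPreconnected {z : Plane | R < ‖z‖} := by
  have hrank : 1 < Module.rank ℝ Plane := by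
    rw [← Module.finrank_eq_rank]
    simp
  have hS := isPreconnected_sphere hrank 0 1
  have := (isPreconnected_Ioi (a := R)).prod hS
  have h2 := this.image (fun p : ℝ × Plane => p.1 • p.2) (by fun_prop)
  convert h2 using 1
  ext z
  constructor
  · intro hz
    have hz0 : 0 < ‖z‖ := hR.trans_lt hz
    refine ⟨(‖z‖, ‖z‖⁻¹ • z), ⟨hz, ?_⟩, ?_⟩
    · simp [norm_smul, hz0.ne']
    · simp [smul_smul, hz0.ne']
  · rintro ⟨⟨t, x⟩, ⟨ht, hx⟩, rfl⟩
    have hx' : ‖x‖ = 1 := by simpa using hx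
    have ht' : R < t := ht
    simp only [mem_ofPred_eq, norm_smul, hx', mul_one, Real.norm_eq_abs]
    exact ht'.trans_le (le_abs_self t)

theorem exists_subset_extRegion (hK : IsCompact K) :
    ∃ R : ℝ, 0 ≤ R ∧ {z : Plane | R < ‖z‖} ⊆ extRegion K := by
  obtain ⟨R, hR⟩ := hK.isBounded.exists_norm_le
  refine ⟨max R 0, le_max_right _ _, fun z hz => ?_⟩
  have hsub : {z : Plane | max R 0 < ‖z‖} ⊆ Kᶜ := fun y hy hyK =>
    absurd (hR y hyK) (not_le.2 ((le_max_left _ _).trans_lt hy))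
  refine ⟨hsub hz, fun hb => ?_⟩
  have hc := (isPreconnected_setOf_lt_norm (le_max_right R 0)).subset_connectedComponentIn hz hsub
  obtain ⟨M, hM⟩ := (hb.subset hc).exists_norm_le
  have := hM (max (max R 0) M + 1, 0) (by
    simp only [mem_ofPred_eq, Prod.norm_mk, norm_zero]
    refine lt_of_lt_of_le ?_ (le_max_left _ _)
    rw [Real.norm_eq_abs]
    exact (lt_of_le_of_lt (le_max_left _ M) (lt_add_one _)).trans_le (le_abs_self _))
  rw [Prod.norm_mk, Real.norm_eq_abs] at this
  have h2 := (le_abs_self (max (max R 0) M + 1)).trans ((le_max_left _ _).trans this)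
  linarith [le_max_right (max R 0) M]

theorem connectedComponentIn_eq_of_mem_extRegion (hK : IsCompact K) {z w : Plane}
    (hz : z ∈ extRegion K) (hw : w ∈ extRegion K) :
    connectedComponentIn Kᶜ z = connectedComponentIn Kᶜ w := by
  obtain ⟨R, hR0, hR⟩ := exists_subset_extRegion hK
  have key : ∀ z ∈ extRegion K, ∃ y ∈ connectedComponentIn Kᶜ z, R < ‖y‖ := by
    intro z hz
    by_contra! h
    exact hz.2 ((Metric.isBounded_closedBall (x := (0 : Plane)) (r := R)).subset fun y hy => by
      simpa using h y hy)
  obtain ⟨y, hy, hyR⟩ := key z hz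
  obtain ⟨y', hy', hyR'⟩ := key w hw
  have hyy' : y' ∈ connectedComponentIn Kᶜ y :=
    (isPreconnected_setOf_lt_norm hR0).subset_connectedComponentIn hyR
      (hR.trans fun x hx => hx.1) hyR'
  rw [connectedComponentIn_eq hy, connectedComponentIn_eq hyy', connectedComponentIn_eq hy']

/-- In a bounded complementary component of `K`, the function `z - a` has no logarithm. -/
theorem not_hasLogOn_of_mem_intRegion (hK : IsClosed K) (ha : a ∈ intRegion K) :
    ¬ HasLogOn (fun z => planeToComplex (z - a)) K := by
  classical
  rintro ⟨g, hg, hgf⟩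
  set U := connectedComponentIn Kᶜ a with hU
  obtain ⟨G, hG⟩ := ContinuousMap.exists_restrict_eq hK ⟨K.domRestrict g, hg.domRestrict⟩
  have hGg : ∀ x ∈ K, G x = g x := fun x hx => DFunLike.congr_fun hG ⟨x, hx⟩
  let F : Plane → ℂ := U.piecewise (fun z => Complex.exp (G z)) (fun z => planeToComplex (z - a))
  have hF : Continuous F := by
    refine Continuous.piecewise (fun x hx => ?_) (by fun_prop) (by fun_prop)
    have hxK := frontier_connectedComponentIn_subset hK hx
    rw [hGg x hxK, hgf x hxK]
  have hFne : ∀ z, F z ≠ 0 := by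
    intro z
    by_cases hz : z ∈ U
    · simp only [F, piecewise_eq_of_mem _ _ _ hz]; exact Complex.exp_ne_zero _
    · simp only [F, piecewise_eq_of_notMem _ _ _ hz]
      exact planeToComplex_sub_ne_zero fun h => hz (h ▸ mem_connectedComponentIn ha.1)
  obtain ⟨R, hR⟩ : ∃ R, ∀ z ∈ U, ‖planeToComplex (z - a)‖ ≤ R := by
    obtain ⟨R, hR⟩ := ha.2.exists_norm_le
    refine ⟨‖(planeToComplex : Plane →L[ℝ] ℂ)‖ * (R + ‖a‖), fun z hz => ?_⟩
    refine ((planeToComplex : Plane →L[ℝ] ℂ).le_opNorm _).trans ?_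
    gcongr
    exact (norm_sub_le _ _).trans (by gcongr; exact hR z hz)
  have hR0 : 0 < |R| + 1 := by positivity
  refine not_hasLogOn_circle a hR0 (((hasLogOn_univ hF hFne).mono (subset_univ _)).congr ?_)
  intro z hz
  have hzU : z ∉ U := fun h => by
    have := hR z h
    rw [hz] at this
    linarith [le_abs_self R]
  simp [F, piecewise_eq_of_notMem _ _ _ hzU]

/-- In the unbounded complementary component of `K`, the function `z - a` has a logarithm. -/
theorem hasLogOn_of_mem_extRegion (hK : IsCompact K) (ha : a ∈ extRegion K) :
    HasLogOn (fun z => planeToComplex (z - a)) K := by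
  obtain ⟨R, hR⟩ : ∃ R, ∀ z ∈ K, ‖planeToComplex z‖ ≤ R := by
    obtain ⟨R, hR⟩ := (hK.image planeToComplex.continuous).isBounded.exists_norm_le
    exact ⟨R, fun z hz => hR _ ⟨z, hz, rfl⟩⟩
  obtain ⟨b, hb, hbR⟩ : ∃ b ∈ connectedComponentIn Kᶜ a, |R| < ‖planeToComplex b‖ := by
    by_contra! h
    refine ha.2 (((planeToComplex.symm : ℂ →L[ℝ] Plane).lipschitz.isBounded_image
      (Metric.isBounded_closedBall (x := (0 : ℂ)) (r := |R|))).subset fun y hy => ?_)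
    exact ⟨planeToComplex y, by simpa using h y hy, by simp⟩
  have hb0 : planeToComplex b ≠ 0 := norm_pos_iff.1 ((abs_nonneg R).trans_lt hbR)
  have hpc : IsPathConnected (connectedComponentIn Kᶜ a) :=
    (hK.isClosed.isOpen_compl.connectedComponentIn.isConnected_iff_isPathConnected).1
      (isConnected_connectedComponentIn_iff.2 ha.1)
  obtain ⟨γ, hγ⟩ := hpc.joinedIn a (mem_connectedComponentIn ha.1) b hb
  have h1 := hasLogOn_div_of_path γ (S := K) fun t => connectedComponentIn_subset _ _ (hγ t)
  have hslit : ∀ z ∈ K, 1 + -(planeToComplex z / planeToComplex b) ∈ Complex.slitPlane := by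
    intro z hz
    apply Complex.mem_slitPlane_of_norm_lt_one
    rw [norm_neg, norm_div, div_lt_one (norm_pos_iff.2 hb0)]
    exact (hR z hz).trans_lt ((le_abs_self R).trans_lt hbR)
  have h2 : HasLogOn (fun z => 1 + -(planeToComplex z / planeToComplex b)) K :=
    ⟨fun z => Complex.log (1 + -(planeToComplex z / planeToComplex b)),
      ContinuousOn.clog (by fun_prop) hslit, fun z hz =>
        Complex.exp_log (Complex.slitPlane_ne_zero (hslit z hz))⟩
  refine (h1.mul ((HasLogOn.const (neg_ne_zero.2 hb0) K).mul h2)).congr fun z hz => ?_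
  have hzb : planeToComplex (z - b) ≠ 0 :=
    planeToComplex_sub_ne_zero fun h => connectedComponentIn_subset _ _ hb (h ▸ hz)
  have : -planeToComplex b * (1 + -(planeToComplex z / planeToComplex b))
      = planeToComplex (z - b) := by
    rw [map_sub]; field_simp; ring
  rw [this, div_mul_cancel₀ _ hzb]

theorem mem_extRegion_iff_hasLogOn (hK : IsCompact K) (ha : a ∉ K) :
    a ∈ extRegion K ↔ HasLogOn (fun z => planeToComplex (z - a)) K :=
  ⟨hasLogOn_of_mem_extRegion hK, fun h => ⟨ha, fun hb =>
    not_hasLogOn_of_mem_intRegion hK.isClosed ⟨ha, hb⟩ h⟩⟩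

theorem isPreconnected_compl_of_hasLogOn (hK : IsCompact K)
    (h : ∀ a ∉ K, HasLogOn (fun z => planeToComplex (z - a)) K) : IsPreconnected Kᶜ := by
  rcases Kᶜ.eq_empty_or_nonempty with h0 | ⟨x, hx⟩
  · rw [h0]; exact isPreconnected_empty
  have hext : ∀ y ∈ Kᶜ, y ∈ extRegion K := fun y hy =>
    (mem_extRegion_iff_hasLogOn hK hy).2 (h y hy)
  have : Kᶜ = connectedComponentIn Kᶜ x := by
    refine Subset.antisymm (fun y hy => ?_) (connectedComponentIn_subset _ _)
    rw [connectedComponentIn_eq_of_mem_extRegion hK (hext x hx) (hext y hy)]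
    exact mem_connectedComponentIn hy
  rw [this]
  exact isPreconnected_connectedComponentIn

end Components

/-- The properties of Jordan curves used below: `J` is compact, its complement has a bounded
component, and `J` is contained in the closure of every component of its complement. -/
structure IsJordanLike (J : Set Plane) : Prop where
  isCompact : IsCompact J
  nonempty_intRegion : (intRegion J).Nonempty
  subset_closure : ∀ z ∉ J, J ⊆ closure (connectedComponentIn Jᶜ z)

/-- Two simple arcs with the same endpoints which are otherwise disjoint. -/
structure IsBigon (φ ψ : ℝ → Plane) (a b : ℝ) : Prop where
  continuous_left : Continuous φ
  continuous_right : Continuous ψ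
  injective_left : φ.Injective
  injective_right : ψ.Injective
  lt : a < b
  eq_source : φ a = ψ a
  eq_target : φ b = ψ b
  ne : ∀ t ∈ Icc a b, ∀ s ∈ Ioo a b, φ t ≠ ψ s

namespace IsBigon

variable {φ ψ : ℝ → Plane} {a b : ℝ}

theorem eq_or_eq (h : IsBigon φ ψ a b) {s t : ℝ} (hs : s ∈ Icc a b) (ht : t ∈ Icc a b)
    (hst : φ s = ψ t) : s = a ∧ t = a ∨ s = b ∧ t = b := by
  rcases eq_or_lt_of_le ht.1 with rfl | h1
  · exact Or.inl ⟨h.injective_left (hst.trans h.eq_source.symm), rfl⟩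
  rcases eq_or_lt_of_le ht.2 with rfl | h2
  · exact Or.inr ⟨h.injective_left (hst.trans h.eq_target.symm), rfl⟩
  exact absurd hst (h.ne s hs t ⟨h1, h2⟩)

theorem symm (h : IsBigon φ ψ a b) : IsBigon ψ φ a b where
  continuous_left := h.continuous_right
  continuous_right := h.continuous_left
  injective_left := h.injective_right
  injective_right := h.injective_left
  lt := h.lt
  eq_source := h.eq_source.symm
  eq_target := h.eq_target.symm
  ne t ht s hs hts := by
    rcases h.eq_or_eq (Ioo_subset_Icc_self hs) ht hts.symm with ⟨rfl, -⟩ | ⟨rfl, -⟩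
    · exact lt_irrefl _ hs.1
    · exact lt_irrefl _ hs.2

theorem isCompact (h : IsBigon φ ψ a b) : IsCompact (φ '' Icc a b ∪ ψ '' Icc a b) :=
  (isCompact_Icc.image h.continuous_left).union (isCompact_Icc.image h.continuous_right)

theorem inter_eq (h : IsBigon φ ψ a b) : φ '' Icc a b ∩ ψ '' Icc a b = {φ a, φ b} := by
  ext z
  constructor
  · rintro ⟨⟨s, hs, rfl⟩, ⟨t, ht, hst⟩⟩
    rcases h.eq_or_eq hs ht hst.symm with ⟨rfl, -⟩ | ⟨rfl, -⟩ <;> simp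
  · rintro (rfl | rfl)
    · exact ⟨⟨a, left_mem_Icc.2 h.lt.le, rfl⟩, ⟨a, left_mem_Icc.2 h.lt.le, h.eq_source.symm⟩⟩
    · exact ⟨⟨b, right_mem_Icc.2 h.lt.le, rfl⟩, ⟨b, right_mem_Icc.2 h.lt.le, h.eq_target.symm⟩⟩

/-- The quotient `(z - φ a) / (z - φ b)` has a logarithm off an arc from `φ a` to `φ b`. -/
theorem _root_.hasLogOn_compl_arc {φ : ℝ → Plane} (hφ : Continuous φ) {a b : ℝ} (hab : a ≤ b) :
    HasLogOn (fun z => planeToComplex (z - φ a) / planeToComplex (z - φ b)) (φ '' Icc a b)ᶜ := by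
  have hpc : IsPathConnected (φ '' Icc a b) :=
    ((convex_Icc a b).isPathConnected ⟨a, left_mem_Icc.2 hab⟩).image hφ
  obtain ⟨γ, hγ⟩ := hpc.joinedIn _ ⟨a, left_mem_Icc.2 hab, rfl⟩ _ ⟨b, right_mem_Icc.2 hab, rfl⟩
  exact hasLogOn_div_of_path γ fun t => not_not.2 (hγ t)

theorem _root_.not_hasLogOn_compl_pair {p q : Plane} (hpq : p ≠ q) :
    ¬ HasLogOn (fun z => planeToComplex (z - p) / planeToComplex (z - q)) {p, q}ᶜ := by
  intro hlog
  have hpq0 : planeToComplex (p - q) ≠ 0 := planeToComplex_sub_ne_zero hpq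
  have hr : 0 < ‖planeToComplex (p - q)‖ := norm_pos_iff.2 hpq0
  set C := {z | ‖planeToComplex (z - p)‖ = ‖planeToComplex (p - q)‖ / 2} with hC
  have hCp : ∀ z ∈ C, z ≠ p := by
    rintro z hz rfl
    have : ‖planeToComplex (z - z)‖ = ‖planeToComplex (z - q)‖ / 2 := hz
    rw [sub_self, map_zero, norm_zero] at this
    linarith
  have hslit : ∀ z ∈ C,
      1 + planeToComplex (z - p) / planeToComplex (p - q) ∈ Complex.slitPlane := by
    intro z hz
    apply Complex.mem_slitPlane_of_norm_lt_one
    have : ‖planeToComplex (z - p)‖ = ‖planeToComplex (p - q)‖ / 2 := hz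
    rw [norm_div, div_lt_one hr, this]
    linarith
  have hfac : ∀ z, planeToComplex (p - q) * (1 + planeToComplex (z - p) / planeToComplex (p - q))
      = planeToComplex (z - q) := by
    intro z
    rw [mul_add, mul_div_cancel₀ _ hpq0, mul_one, ← map_add]
    congr 1; abel
  have hne : ∀ z ∈ C, planeToComplex (z - q) ≠ 0 := fun z hz => by
    rw [← hfac z]
    exact mul_ne_zero hpq0 (Complex.slitPlane_ne_zero (hslit z hz))
  have hCq : ∀ z ∈ C, z ≠ q := by
    rintro z hz rfl
    exact hne z hz (by simp)
  have h2 : HasLogOn (fun z => 1 + planeToComplex (z - p) / planeToComplex (p - q)) C :=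
    ⟨fun z => Complex.log (1 + planeToComplex (z - p) / planeToComplex (p - q)),
      ContinuousOn.clog (by fun_prop) hslit, fun z hz =>
        Complex.exp_log (Complex.slitPlane_ne_zero (hslit z hz))⟩
  have hsub : C ⊆ {p, q}ᶜ := by
    rintro z hz (rfl | rfl)
    · exact hCp z hz rfl
    · exact hCq z hz rfl
  refine not_hasLogOn_circle p (half_pos hr) (((hlog.mono hsub).mul
    ((HasLogOn.const hpq0 C).mul h2)).congr fun z hz => ?_)
  rw [hfac, div_mul_cancel₀ _ (hne z hz)]

theorem not_isPreconnected_compl (h : IsBigon φ ψ a b) :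
    ¬ IsPreconnected (φ '' Icc a b ∪ ψ '' Icc a b)ᶜ := by
  intro hc
  rw [compl_union] at hc
  have h1 := hasLogOn_compl_arc h.continuous_left h.lt.le
  have h2 := hasLogOn_compl_arc h.continuous_right h.lt.le
  rw [← h.eq_source, ← h.eq_target] at h2
  have h3 := h1.union_of_isOpen h2 hc
    (isCompact_Icc.image h.continuous_left).isClosed.isOpen_compl
    (isCompact_Icc.image h.continuous_right).isClosed.isOpen_compl
  rw [← compl_inter, h.inter_eq] at h3
  exact not_hasLogOn_compl_pair (fun he => h.lt.ne (h.injective_left he)) h3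

theorem image_Ioo_subset_closure (h : IsBigon φ ψ a b) {z : Plane}
    (hz : z ∉ φ '' Icc a b ∪ ψ '' Icc a b) :
    φ '' Ioo a b ⊆ closure (connectedComponentIn (φ '' Icc a b ∪ ψ '' Icc a b)ᶜ z) := by
  set J := φ '' Icc a b ∪ ψ '' Icc a b with hJ
  rintro _ ⟨t₀, ht₀, rfl⟩
  by_contra hx
  set U := connectedComponentIn Jᶜ z with hU
  have hφ := h.continuous_left
  have hN : φ ⁻¹' (closure U)ᶜ ∩ Ioo a b ∈ 𝓝 t₀ :=
    (((isClosed_closure.isOpen_compl).preimage hφ).inter isOpen_Ioo).mem_nhds ⟨hx, ht₀⟩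
  obtain ⟨ε, hε, hball⟩ := Metric.mem_nhds_iff.1 hN
  rw [Real.ball_eq_Ioo] at hball
  set s := t₀ - ε / 2 with hs
  set t := t₀ + ε / 2 with ht
  have hsm := hball (show s ∈ Ioo (t₀ - ε) (t₀ + ε) from ⟨by linarith, by linarith⟩)
  have htm := hball (show t ∈ Ioo (t₀ - ε) (t₀ + ε) from ⟨by linarith, by linarith⟩)
  have has : a < s := hsm.2.1
  have htb : t < b := htm.2.2
  set B := (φ '' Icc a s ∪ ψ '' Icc a b) ∪ φ '' Icc t b with hB
  have hcφ : ∀ x y, IsCompact (φ '' Icc x y) := fun x y => isCompact_Icc.image hφ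
  have hcψ : IsCompact (ψ '' Icc a b) := isCompact_Icc.image h.continuous_right
  have hBc : IsCompact B := ((hcφ _ _).union hcψ).union (hcφ _ _)
  have hBJ : B ⊆ J := by
    refine union_subset (union_subset ?_ subset_union_right) ?_
    · exact (image_mono (Icc_subset_Icc_right (by linarith))).trans subset_union_left
    · exact (image_mono (Icc_subset_Icc_left (by linarith))).trans subset_union_left
  have hJB : ∀ x ∈ J, x ∉ B → x ∉ closure U := by
    rintro x (⟨r, hr, rfl⟩ | hx) hxB
    · have h1 : s < r := by
        by_contra! hc
        exact hxB (Or.inl (Or.inl ⟨r, ⟨hr.1, hc⟩, rfl⟩))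
      have h2 : r < t := by
        by_contra! hc
        exact hxB (Or.inr ⟨r, ⟨hc, hr.2⟩, rfl⟩)
      exact (hball ⟨by linarith, by linarith⟩).1
    · exact absurd (Or.inl (Or.inr hx)) hxB
  have hBconn : IsPreconnected Bᶜ := by
    refine isPreconnected_compl_of_hasLogOn hBc fun w hw => ?_
    have hlog : ∀ {χ : ℝ → Plane}, Continuous χ → χ.Injective → ∀ x y,
        χ '' Icc x y ⊆ B → HasLogOn (fun z => planeToComplex (z - w)) (χ '' Icc x y) :=
      fun hχ hχi x y hsub => hasLogOn_arc hχ hχi x y (by fun_prop) fun v hv =>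
        planeToComplex_sub_ne_zero fun hvw => hw (hvw ▸ hsub hv)
    refine ((hlog hφ h.injective_left _ _ ?_).union_of_isClosed
      (hlog h.continuous_right h.injective_right _ _ ?_) ?_ (hcφ _ _).isClosed
        hcψ.isClosed).union_of_isClosed (hlog hφ h.injective_left _ _ ?_) ?_
      ((hcφ _ _).union hcψ).isClosed (hcφ _ _).isClosed
    · exact subset_union_left.trans subset_union_left
    · exact subset_union_right.trans subset_union_left
    · refine Set.Subsingleton.isPreconnected (subsingleton_of_subset_singleton (a := φ a) ?_)
      rintro _ ⟨⟨r, hr, rfl⟩, ⟨r', hr', hrr'⟩⟩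
      rcases h.eq_or_eq ⟨hr.1, by linarith [hr.2]⟩ hr' hrr'.symm with ⟨rfl, -⟩ | ⟨rfl, -⟩
      · rfl
      · linarith [hr.2]
    · exact subset_union_right
    · refine Set.Subsingleton.isPreconnected (subsingleton_of_subset_singleton (a := φ b) ?_)
      rintro _ ⟨⟨r', hr', hrr'⟩ | ⟨r', hr', hrr'⟩, ⟨r, hr, rfl⟩⟩
      · have := h.injective_left hrr'
        linarith [hr.1, hr'.2]
      · rcases h.eq_or_eq ⟨by linarith [hr.1], hr.2⟩ hr' hrr'.symm with ⟨rfl, -⟩ | ⟨rfl, -⟩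
        · linarith [hr.1]
        · rfl
  have hUJ : U ⊆ Jᶜ := connectedComponentIn_subset _ _
  obtain ⟨y, hyJ, hyU⟩ : ∃ y ∈ Jᶜ, y ∉ U := by
    by_contra! hc
    refine h.not_isPreconnected_compl ?_
    rw [Subset.antisymm hc hUJ]
    exact isPreconnected_connectedComponentIn
  have hcov : ∀ x ∈ Bᶜ, x ∈ closure U → x ∈ U := by
    intro x hxB hxU
    by_contra hxU'
    refine hJB x (frontier_connectedComponentIn_subset h.isCompact.isClosed
      (a := z) ⟨hxU, fun hi => hxU' (interior_subset hi)⟩) hxB hxU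
  obtain ⟨x, -, hxU, hxU'⟩ := hBconn U (closure U)ᶜ
    h.isCompact.isClosed.isOpen_compl.connectedComponentIn isClosed_closure.isOpen_compl
    (fun x hx => or_iff_not_imp_right.2 fun hxU => hcov x hx (not_not.1 hxU))
    ⟨z, fun hzB => hz (hBJ hzB), mem_connectedComponentIn hz⟩
    ⟨y, fun hyB => hyJ (hBJ hyB), fun hc => hyU (hcov y (fun hyB => hyJ (hBJ hyB)) hc)⟩
  exact hxU' (subset_closure hxU)

theorem isJordanLike (h : IsBigon φ ψ a b) : IsJordanLike (φ '' Icc a b ∪ ψ '' Icc a b) where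
  isCompact := h.isCompact
  nonempty_intRegion := by
    by_contra hne
    rw [not_nonempty_iff_eq_empty] at hne
    refine h.not_isPreconnected_compl (isPreconnected_compl_of_hasLogOn h.isCompact fun w hw =>
      hasLogOn_of_mem_extRegion h.isCompact ⟨hw, fun hb => ?_⟩)
    have : w ∈ intRegion (φ '' Icc a b ∪ ψ '' Icc a b) := ⟨hw, hb⟩
    rw [hne] at this
    exact this
  subset_closure z hz := by
    have key : ∀ {χ : ℝ → Plane} {V : Set Plane}, Continuous χ → χ '' Ioo a b ⊆ closure V →
        χ '' Icc a b ⊆ closure V := fun {χ V} hχ hV => by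
      rw [← closure_Ioo h.lt.ne]
      exact (image_closure_subset_closure_image hχ).trans (closure_minimal hV isClosed_closure)
    refine union_subset (key h.continuous_left (h.image_Ioo_subset_closure hz))
      (key h.continuous_right ?_)
    have := h.symm.image_Ioo_subset_closure (z := z)
    rw [union_comm (ψ '' _)] at this
    exact this hz

end IsBigon

/-- Three continua `A₁`, `A₂`, `A₃` joining `p` to `q` and otherwise disjoint, such that the
union of any two of them behaves like a Jordan curve. -/
structure IsTheta (A₁ A₂ A₃ : Set Plane) (p q : Plane) : Prop where
  jordan₁ : IsJordanLike (A₂ ∪ A₃)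
  jordan₂ : IsJordanLike (A₁ ∪ A₃)
  jordan₃ : IsJordanLike (A₁ ∪ A₂)
  conn₁ : IsPreconnected A₁
  conn₂ : IsPreconnected A₂
  conn₃ : IsPreconnected A₃
  inter₁ : A₂ ∩ A₃ = {p, q}
  inter₂ : A₁ ∩ A₃ = {p, q}
  inter₃ : A₁ ∩ A₂ = {p, q}
  conn_diff₁ : IsPreconnected (A₁ \ {p, q})
  conn_diff₂ : IsPreconnected (A₂ \ {p, q})
  conn_diff₃ : IsPreconnected (A₃ \ {p, q})
  nonempty_diff₁ : (A₁ \ {p, q}).Nonempty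
  nonempty_diff₂ : (A₂ \ {p, q}).Nonempty
  nonempty_diff₃ : (A₃ \ {p, q}).Nonempty

namespace IsTheta

variable {A₁ A₂ A₃ : Set Plane} {p q : Plane}

theorem swap₁₂ (h : IsTheta A₁ A₂ A₃ p q) : IsTheta A₂ A₁ A₃ p q where
  jordan₁ := h.jordan₂
  jordan₂ := h.jordan₁
  jordan₃ := union_comm A₁ A₂ ▸ h.jordan₃
  conn₁ := h.conn₂
  conn₂ := h.conn₁
  conn₃ := h.conn₃
  inter₁ := h.inter₂
  inter₂ := h.inter₁
  inter₃ := inter_comm A₁ A₂ ▸ h.inter₃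
  conn_diff₁ := h.conn_diff₂
  conn_diff₂ := h.conn_diff₁
  conn_diff₃ := h.conn_diff₃
  nonempty_diff₁ := h.nonempty_diff₂
  nonempty_diff₂ := h.nonempty_diff₁
  nonempty_diff₃ := h.nonempty_diff₃

theorem swap₂₃ (h : IsTheta A₁ A₂ A₃ p q) : IsTheta A₁ A₃ A₂ p q where
  jordan₁ := union_comm A₂ A₃ ▸ h.jordan₁
  jordan₂ := h.jordan₃
  jordan₃ := h.jordan₂
  conn₁ := h.conn₁
  conn₂ := h.conn₃
  conn₃ := h.conn₂
  inter₁ := inter_comm A₂ A₃ ▸ h.inter₁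
  inter₂ := h.inter₃
  inter₃ := h.inter₂
  conn_diff₁ := h.conn_diff₁
  conn_diff₂ := h.conn_diff₃
  conn_diff₃ := h.conn_diff₂
  nonempty_diff₁ := h.nonempty_diff₁
  nonempty_diff₂ := h.nonempty_diff₃
  nonempty_diff₃ := h.nonempty_diff₂

theorem diff_subset_compl (h : IsTheta A₁ A₂ A₃ p q) : A₁ \ {p, q} ⊆ (A₂ ∪ A₃)ᶜ := by
  rintro x ⟨hx, hpq⟩ (h2 | h3)
  · exact hpq (h.inter₃ ▸ ⟨hx, h2⟩)
  · exact hpq (h.inter₂ ▸ ⟨hx, h3⟩)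

theorem subset_diff_union (h : IsTheta A₁ A₂ A₃ p q) : A₁ ⊆ A₁ \ {p, q} ∪ (A₂ ∪ A₃) := by
  intro x hx
  by_cases hpq : x ∈ ({p, q} : Set Plane)
  · exact Or.inr (Or.inl (h.inter₃ ▸ hpq : x ∈ A₁ ∩ A₂).2)
  · exact Or.inl ⟨hx, hpq⟩

theorem diff_subset_or (h : IsTheta A₁ A₂ A₃ p q) :
    A₁ \ {p, q} ⊆ intRegion (A₂ ∪ A₃) ∨ A₁ \ {p, q} ⊆ extRegion (A₂ ∪ A₃) :=
  subset_intRegion_or_subset_extRegion h.conn_diff₁ h.diff_subset_compl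

theorem _root_.IsJordanLike.subset_closure_intRegion {J : Set Plane} (hJ : IsJordanLike J) :
    J ⊆ closure (intRegion J) := by
  obtain ⟨z, hz⟩ := hJ.nonempty_intRegion
  exact (hJ.subset_closure z hz.1).trans (closure_mono (connectedComponentIn_subset_intRegion hz))

theorem subset_closure_intRegion_iff (h : IsTheta A₁ A₂ A₃ p q) :
    A₁ ∪ A₂ ⊆ closure (intRegion (A₂ ∪ A₃)) ↔ A₁ \ {p, q} ⊆ intRegion (A₂ ∪ A₃) := by
  constructor
  · intro hsub
    refine h.diff_subset_or.resolve_right fun hext => ?_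
    obtain ⟨x, hx⟩ := h.nonempty_diff₁
    obtain ⟨y, hy, hy'⟩ := mem_closure_iff.1 (hsub (Or.inl hx.1)) _
      (isOpen_extRegion h.jordan₁.isCompact.isClosed) (hext hx)
    exact Set.disjoint_left.1 disjoint_intRegion_extRegion hy' hy
  · intro hint
    have hJ := h.jordan₁.subset_closure_intRegion
    refine union_subset (h.subset_diff_union.trans (union_subset ?_ hJ))
      (subset_union_left.trans hJ)
    exact hint.trans subset_closure

/-- If `A₁` is not met by the component `V` of the complement of `A₂ ∪ A₃` containing `z`, then
`V` is contained in the component of the complement of `A₁ ∪ A₃` containing `z`. -/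
theorem component_subset (h : IsTheta A₁ A₂ A₃ p q) {z : Plane} (hz : z ∉ A₂ ∪ A₃)
    (hd : Disjoint (connectedComponentIn (A₂ ∪ A₃)ᶜ z) (A₁ \ {p, q})) :
    connectedComponentIn (A₂ ∪ A₃)ᶜ z ⊆ connectedComponentIn (A₁ ∪ A₃)ᶜ z := by
  refine isPreconnected_connectedComponentIn.subset_connectedComponentIn
    (mem_connectedComponentIn hz) fun y hy => ?_
  have hy' : y ∉ A₂ ∪ A₃ := connectedComponentIn_subset _ _ hy
  rintro (h1 | h3)
  · rcases h.subset_diff_union h1 with h1' | h1'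
    · exact Set.disjoint_left.1 hd hy h1'
    · exact hy' h1'
  · exact hy' (Or.inr h3)

/-- No complementary component of `A₂ ∪ A₃` missing `A₁` is also a complementary component of
`A₁ ∪ A₃` missing `A₂`. -/
theorem false_of_disjoint (h : IsTheta A₁ A₂ A₃ p q) {z : Plane} (hz₁ : z ∉ A₂ ∪ A₃)
    (hz₂ : z ∉ A₁ ∪ A₃)
    (hd₁ : Disjoint (connectedComponentIn (A₂ ∪ A₃)ᶜ z) (A₁ \ {p, q}))
    (hd₂ : Disjoint (connectedComponentIn (A₁ ∪ A₃)ᶜ z) (A₂ \ {p, q})) : False := by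
  have heq := Subset.antisymm (h.component_subset hz₁ hd₁) (h.swap₁₂.component_subset hz₂ hd₂)
  obtain ⟨x, hx⟩ := h.nonempty_diff₂
  have hxcl := h.jordan₁.subset_closure z hz₁ (Or.inl hx.1)
  rw [heq] at hxcl
  have hxc : x ∉ A₁ ∪ A₃ := h.swap₁₂.diff_subset_compl hx
  have hxz : x ∈ connectedComponentIn (A₁ ∪ A₃)ᶜ z := by
    by_contra hn
    exact hxc (frontier_connectedComponentIn_subset h.jordan₂.isCompact.isClosed (a := z)
      ⟨hxcl, fun hi => hn (interior_subset hi)⟩)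
  exact Set.disjoint_left.1 hd₂ hxz hx

theorem not_both (h : IsTheta A₁ A₂ A₃ p q) (h₁ : A₁ \ {p, q} ⊆ intRegion (A₂ ∪ A₃))
    (h₂ : A₂ \ {p, q} ⊆ intRegion (A₁ ∪ A₃)) : False := by
  obtain ⟨R₁, hR₁, hsub₁⟩ := exists_subset_extRegion h.jordan₁.isCompact
  obtain ⟨R₂, hR₂, hsub₂⟩ := exists_subset_extRegion h.jordan₂.isCompact
  let z : Plane := (R₁ + R₂ + 1, 0)
  have hz : R₁ + R₂ < ‖z‖ := by
    refine lt_of_lt_of_le (lt_add_one _) ((le_abs_self _).trans ?_)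
    exact norm_fst_le z
  have hz₁ : z ∈ extRegion (A₂ ∪ A₃) := hsub₁ (show R₁ < ‖z‖ by linarith)
  have hz₂ : z ∈ extRegion (A₁ ∪ A₃) := hsub₂ (show R₂ < ‖z‖ by linarith)
  exact h.false_of_disjoint hz₁.1 hz₂.1
    (disjoint_intRegion_extRegion.symm.mono (connectedComponentIn_subset_extRegion hz₁) h₁)
    (disjoint_intRegion_extRegion.symm.mono (connectedComponentIn_subset_extRegion hz₂) h₂)

/-- A point off a theta curve which lies in the unbounded components of the complements of two of
its three cycles also lies in the unbounded component of the complement of the third. -/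
theorem mem_extRegion (h : IsTheta A₁ A₂ A₃ p q) {z : Plane} (h₁ : z ∈ extRegion (A₂ ∪ A₃))
    (h₂ : z ∈ extRegion (A₁ ∪ A₃)) : z ∈ extRegion (A₁ ∪ A₂) := by
  have hz : z ∉ A₁ ∪ A₂ := by
    rintro (hz | hz)
    · exact h₂.1 (Or.inl hz)
    · exact h₁.1 (Or.inl hz)
  rw [mem_extRegion_iff_hasLogOn h.jordan₃.isCompact hz]
  have hinter : (A₂ ∪ A₃) ∩ (A₁ ∪ A₃) = A₃ := by
    rw [← inter_union_distrib_right, inter_comm, h.inter₃, ← h.inter₁]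
    exact union_eq_right.2 inter_subset_right
  refine ((hasLogOn_of_mem_extRegion h.jordan₁.isCompact h₁).union_of_isClosed
    (hasLogOn_of_mem_extRegion h.jordan₂.isCompact h₂) (by rw [hinter]; exact h.conn₃)
    h.jordan₁.isCompact.isClosed h.jordan₂.isCompact.isClosed).mono ?_
  exact union_subset (subset_union_left.trans subset_union_right)
    (subset_union_left.trans subset_union_left)

theorem not_all_ext (h : IsTheta A₁ A₂ A₃ p q) (h₁ : A₁ \ {p, q} ⊆ extRegion (A₂ ∪ A₃))
    (h₂ : A₂ \ {p, q} ⊆ extRegion (A₁ ∪ A₃)) (h₃ : A₃ \ {p, q} ⊆ extRegion (A₁ ∪ A₂)) :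
    False := by
  have key : ∀ {A₁ A₂ A₃ : Set Plane}, IsTheta A₁ A₂ A₃ p q →
      A₁ \ {p, q} ⊆ extRegion (A₂ ∪ A₃) → A₂ \ {p, q} ⊆ extRegion (A₁ ∪ A₃) →
      ∀ z ∈ intRegion (A₂ ∪ A₃), z ∉ intRegion (A₁ ∪ A₃) := by
    intro A₁ A₂ A₃ h h₁ h₂ z hz₁ hz₂
    exact h.false_of_disjoint hz₁.1 hz₂.1
      (disjoint_intRegion_extRegion.mono (connectedComponentIn_subset_intRegion hz₁) h₁)
      (disjoint_intRegion_extRegion.mono (connectedComponentIn_subset_intRegion hz₂) h₂)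
  obtain ⟨z, hz⟩ := h.jordan₃.nonempty_intRegion
  have hz₃ : z ∉ A₃ := fun hz3 => by
    rcases h.swap₂₃.swap₁₂.subset_diff_union hz3 with hd | hd
    · exact Set.disjoint_left.1 disjoint_intRegion_extRegion hz (h₃ hd)
    · exact hz.1 hd
  have hz₁ : z ∉ A₂ ∪ A₃ := fun hc => hc.elim (fun h2 => hz.1 (Or.inr h2)) hz₃
  have hz₂ : z ∉ A₁ ∪ A₃ := fun hc => hc.elim (fun h1 => hz.1 (Or.inl h1)) hz₃
  have hi : z ∈ intRegion (A₂ ∪ A₃) ∨ z ∈ intRegion (A₁ ∪ A₃) := by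
    by_contra! hn
    exact Set.disjoint_left.1 disjoint_intRegion_extRegion hz
      (h.mem_extRegion ⟨hz₁, fun hb => hn.1 ⟨hz₁, hb⟩⟩ ⟨hz₂, fun hb => hn.2 ⟨hz₂, hb⟩⟩)
  rcases hi with hi | hi
  · exact key h.swap₂₃ (union_comm A₂ A₃ ▸ h₁) h₃ z (union_comm A₂ A₃ ▸ hi) hz
  · exact key h.swap₁₂.swap₂₃ (union_comm A₁ A₃ ▸ h₂) (union_comm A₁ A₂ ▸ h₃) z
      (union_comm A₁ A₃ ▸ hi) (union_comm A₁ A₂ ▸ hz)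

/-- Exactly one of the three arcs of a theta curve lies inside the cycle formed by the others. -/
theorem exactly_one (h : IsTheta A₁ A₂ A₃ p q) {P₁ P₂ P₃ : Prop}
    (h₁ : P₁ ↔ A₁ \ {p, q} ⊆ intRegion (A₂ ∪ A₃))
    (h₂ : P₂ ↔ A₂ \ {p, q} ⊆ intRegion (A₁ ∪ A₃))
    (h₃ : P₃ ↔ A₃ \ {p, q} ⊆ intRegion (A₁ ∪ A₂)) :
    (P₁ ∧ ¬ P₂ ∧ ¬ P₃) ∨ (¬ P₁ ∧ P₂ ∧ ¬ P₃) ∨ (¬ P₁ ∧ ¬ P₂ ∧ P₃) := by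
  have n₁₂ : ¬ (P₁ ∧ P₂) := fun hp => h.not_both (h₁.1 hp.1) (h₂.1 hp.2)
  have n₁₃ : ¬ (P₁ ∧ P₃) := fun hp => h.swap₂₃.not_both (union_comm A₂ A₃ ▸ h₁.1 hp.1) (h₃.1 hp.2)
  have n₂₃ : ¬ (P₂ ∧ P₃) := fun hp => h.swap₁₂.swap₂₃.not_both
    (union_comm A₁ A₃ ▸ h₂.1 hp.1) (union_comm A₁ A₂ ▸ h₃.1 hp.2)
  have hex : P₁ ∨ P₂ ∨ P₃ := by
    by_contra! hn
    refine h.not_all_ext (h.diff_subset_or.resolve_left fun hi => hn.1 (h₁.2 hi))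
      (h.swap₁₂.diff_subset_or.resolve_left fun hi => hn.2.1 (h₂.2 hi))
      (h.swap₂₃.swap₁₂.diff_subset_or.resolve_left fun hi => hn.2.2 (h₃.2 hi))
  tauto

end IsTheta

/-- A continuous injection between complements of bounded open intervals, which is onto,
sends endpoints to endpoints: the left endpoint is not sent below the left endpoint. -/
theorem le_image_left_endpoint {h : ℝ → ℝ} {a b a' b' : ℝ} (hab' : a' < b')
    (hc : ContinuousOn h (Ioo a b)ᶜ) (hi : InjOn h (Ioo a b)ᶜ)
    (him : h '' (Ioo a b)ᶜ = (Ioo a' b')ᶜ) : a' ≤ h a := by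
  by_contra! hlt
  have hl : Iic a ⊆ (Ioo a b)ᶜ := fun t ht hn => not_lt.2 ht hn.1
  have hr : Ici b ⊆ (Ioo a b)ᶜ := fun t ht hn => not_lt.2 ht hn.2
  have hmem : ∀ t ∉ Ioo a b, h t ∉ Ioo a' b' := fun t ht => him.subset (mem_image_of_mem h ht)
  have hcl : (h '' Iic a).OrdConnected := (isPreconnected_Iic.image h (hc.mono hl)).ordConnected
  have hcr : (h '' Ici b).OrdConnected := (isPreconnected_Ici.image h (hc.mono hr)).ordConnected
  have hco : (h '' Iio a).OrdConnected :=
    (isPreconnected_Iio.image h (hc.mono (Iio_subset_Iic_self.trans hl))).ordConnected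
  have hmid : (a' + b') / 2 ∈ Ioo a' b' := ⟨by linarith, by linarith⟩
  have hle : ∀ t ≤ a, h t ≤ a' := by
    intro t ht
    by_contra! hn
    have hb : b' ≤ h t := not_lt.1 fun hlt' => hmem t (hl ht) ⟨hn, hlt'⟩
    obtain ⟨s, hs, hse⟩ := hcl.out (mem_image_of_mem h (mem_Iic.2 le_rfl))
      (mem_image_of_mem h ht) (⟨by linarith, by linarith⟩ : (a' + b') / 2 ∈ Icc (h a) (h t))
    exact hmem s (hl hs) (hse ▸ hmid)
  obtain ⟨s, hs, hsb⟩ := him.superset (fun hn => lt_irrefl _ hn.2 : b' ∉ Ioo a' b')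
  have hbs : s ∈ Ici b := by
    by_contra hn
    have : s ≤ a := not_lt.1 fun hlt' => hs ⟨hlt', not_le.1 hn⟩
    linarith [hle s this]
  have hge : ∀ t ≥ b, b' ≤ h t := by
    intro t ht
    by_contra! hn
    have hb : h t ≤ a' := not_lt.1 fun hlt' => hmem t (hr ht) ⟨hlt', hn⟩
    obtain ⟨u, hu, hue⟩ := hcr.out (mem_image_of_mem h ht) (mem_image_of_mem h hbs)
      (⟨by linarith, by linarith⟩ : (a' + b') / 2 ∈ Icc (h t) (h s))
    exact hmem u (hr hu) (hue ▸ hmid)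
  have hsurj : ∀ y ≤ a', y ≠ h a → y ∈ h '' Iio a := by
    intro y hy hne
    obtain ⟨u, hu, rfl⟩ := him.superset (fun hn => not_lt.2 hy hn.1 : y ∉ Ioo a' b')
    refine ⟨u, lt_of_le_of_ne (not_lt.1 fun hlt' => ?_) fun hua => hne (congrArg h hua), rfl⟩
    have : b ≤ u := not_lt.1 fun hlt'' => hu ⟨hlt', hlt''⟩
    linarith [hge u this]
  obtain ⟨u, hu, hua⟩ := hco.out (hsurj (h a - 1) (by linarith) (by linarith))
    (hsurj a' le_rfl hlt.ne') (⟨by linarith, hlt.le⟩ : h a ∈ Icc (h a - 1) a')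
  exact hu.ne (hi (hl (mem_Iic.2 (le_of_lt hu))) (hl (mem_Iic.2 le_rfl)) hua)

theorem image_left_endpoint {h : ℝ → ℝ} {a b a' b' : ℝ} (hab' : a' < b')
    (hc : ContinuousOn h (Ioo a b)ᶜ) (hi : InjOn h (Ioo a b)ᶜ)
    (him : h '' (Ioo a b)ᶜ = (Ioo a' b')ᶜ) : h a = a' ∨ h a = b' := by
  have h1 := le_image_left_endpoint hab' hc hi him
  have h2 : -b' ≤ -h a := by
    refine le_image_left_endpoint (h := fun t => -h t) (neg_lt_neg hab') hc.neg
      (fun x hx y hy hxy => hi hx hy (neg_injective hxy)) ?_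
    change (Neg.neg ∘ h) '' _ = _
    rw [image_comp, him, image_neg_eq_neg, compl_neg, neg_Ioo]
  have h3 : h a ∉ Ioo a' b' := him.subset (mem_image_of_mem h fun hn => lt_irrefl _ hn.1)
  by_contra! hne
  exact h3 ⟨lt_of_le_of_ne h1 hne.1.symm, lt_of_le_of_ne (neg_le_neg_iff.1 h2) hne.2⟩

theorem image_endpoints {h : ℝ → ℝ} {a b a' b' : ℝ} (hab : a < b) (hab' : a' < b')
    (hc : ContinuousOn h (Ioo a b)ᶜ) (hi : InjOn h (Ioo a b)ᶜ)
    (him : h '' (Ioo a b)ᶜ = (Ioo a' b')ᶜ) : h a = a' ∧ h b = b' ∨ h a = b' ∧ h b = a' := by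
  have hm : ∀ t, t ∈ (Ioo (-b) (-a))ᶜ ↔ -t ∈ (Ioo a b)ᶜ := by
    intro t
    rw [mem_compl_iff, mem_compl_iff, mem_Ioo, mem_Ioo, neg_lt, lt_neg, and_comm]
  have h1 := image_left_endpoint hab' hc hi him
  have h2 : h (- -b) = a' ∨ h (- -b) = b' := by
    refine image_left_endpoint (h := fun t => h (-t)) hab'
      (hc.comp continuous_neg.continuousOn fun t ht => (hm t).1 ht)
      (fun x hx y hy hxy => neg_injective (hi ((hm x).1 hx) ((hm y).1 hy) hxy)) ?_
    change (h ∘ Neg.neg) '' _ = _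
    rw [image_comp, image_neg_eq_neg, ← neg_Ioo, ← compl_neg, neg_neg, him]
  rw [neg_neg] at h2
  have h3 : h a ≠ h b := fun he => hab.ne (hi (fun hn => lt_irrefl _ hn.1)
    (fun hn => lt_irrefl _ hn.2) he)
  rcases h1 with h1 | h1 <;> rcases h2 with h2 | h2
  · exact absurd (h1.trans h2.symm) h3
  · exact Or.inl ⟨h1, h2⟩
  · exact Or.inr ⟨h1, h2⟩
  · exact absurd (h1.trans h2.symm) h3

/-- The curve `ψ` coincides with `φ` outside `Ioo a b`, and the images of `Ioo a b` under `φ` and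
`ψ` are disjoint from the range of the other curve. -/
structure IsDetour (φ ψ : ℝ → Plane) (a b : ℝ) : Prop where
  continuous_left : Continuous φ
  continuous_right : Continuous ψ
  injective_left : φ.Injective
  injective_right : ψ.Injective
  lt : a < b
  eq_off : ∀ t, t ∉ Ioo a b → ψ t = φ t
  left_notMem : ∀ t ∈ Ioo a b, φ t ∉ range ψ
  right_notMem : ∀ t ∈ Ioo a b, ψ t ∉ range φ

namespace IsDetour

variable {φ ψ : ℝ → Plane} {a b : ℝ}

theorem eq_source (h : IsDetour φ ψ a b) : ψ a = φ a := h.eq_off a fun hn => lt_irrefl _ hn.1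

theorem eq_target (h : IsDetour φ ψ a b) : ψ b = φ b := h.eq_off b fun hn => lt_irrefl _ hn.2

theorem isBigon (h : IsDetour φ ψ a b) : IsBigon φ ψ a b where
  continuous_left := h.continuous_left
  continuous_right := h.continuous_right
  injective_left := h.injective_left
  injective_right := h.injective_right
  lt := h.lt
  eq_source := h.eq_source.symm
  eq_target := h.eq_target.symm
  ne t _ s hs hts := h.right_notMem s hs ⟨t, hts⟩

theorem left_mem_iff (h : IsDetour φ ψ a b) {t : ℝ} : φ t ∈ range ψ ↔ t ∉ Ioo a b :=
  ⟨fun hm ht => h.left_notMem t ht hm, fun ht => ⟨t, h.eq_off t ht⟩⟩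

theorem right_mem_iff (h : IsDetour φ ψ a b) {t : ℝ} : ψ t ∈ range φ ↔ t ∉ Ioo a b :=
  ⟨fun hm ht => h.right_notMem t ht hm, fun ht => ⟨t, (h.eq_off t ht).symm⟩⟩

theorem range_diff_left (h : IsDetour φ ψ a b) : range φ \ range ψ = φ '' Ioo a b := by
  ext z
  constructor
  · rintro ⟨⟨t, rfl⟩, hz⟩
    exact ⟨t, not_not.1 fun hn => hz (h.left_mem_iff.2 hn), rfl⟩
  · rintro ⟨t, ht, rfl⟩
    exact ⟨mem_range_self t, h.left_notMem t ht⟩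

theorem range_diff_right (h : IsDetour φ ψ a b) : range ψ \ range φ = ψ '' Ioo a b := by
  ext z
  constructor
  · rintro ⟨⟨t, rfl⟩, hz⟩
    exact ⟨t, not_not.1 fun hn => hz (h.right_mem_iff.2 hn), rfl⟩
  · rintro ⟨t, ht, rfl⟩
    exact ⟨mem_range_self t, h.right_notMem t ht⟩

theorem _root_.closure_image_Ioo {f : ℝ → Plane} (hf : Continuous f) {a b : ℝ} (hab : a < b) :
    closure (f '' Ioo a b) = f '' Icc a b := by
  rw [← closure_Ioo hab.ne]
  refine Subset.antisymm (closure_minimal (image_mono subset_closure) ?_)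
    (image_closure_subset_closure_image hf)
  rw [closure_Ioo hab.ne]
  exact (isCompact_Icc.image hf).isClosed

theorem lineJ_eq (h : IsDetour φ ψ a b) :
    lineJ (range φ) (range ψ) = φ '' Icc a b ∪ ψ '' Icc a b := by
  rw [lineJ, Set.symmDiff_def, h.range_diff_left, h.range_diff_right, closure_union,
    closure_image_Ioo h.continuous_left h.lt, closure_image_Ioo h.continuous_right h.lt]

theorem isJordanLike (h : IsDetour φ ψ a b) : IsJordanLike (lineJ (range φ) (range ψ)) :=
  h.lineJ_eq ▸ h.isBigon.isJordanLike

end IsDetour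

theorem IsPortion.not_subset {γ γ' : Set Plane} (hγ : IsTopLine γ) (hγ' : IsTopLine γ')
    (hne : γ ≠ γ') (hp : IsPortion γ' (γ' \ γ)) : ¬ γ ⊆ γ' := by
  intro hsub
  obtain ⟨Φ⟩ := hγ
  obtain ⟨Ψ⟩ := hγ'
  obtain ⟨a, b, hab⟩ := hp.2 Ψ
  have hmem : ∀ t, t ∈ Ioo a b ↔ (Ψ t : Plane) ∉ γ := by
    intro t
    rw [← hab]
    exact ⟨fun ht => ht.2, fun ht => ⟨(Ψ t).2, ht⟩⟩
  obtain ⟨z, hz', hz⟩ := Set.not_subset.1 fun hsub' => hne (hsub.antisymm hsub')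
  have hm : Ψ.symm ⟨z, hz'⟩ ∈ Ioo a b := by
    rw [hmem, Ψ.apply_symm_apply]
    exact hz
  let h : ℝ → ℝ := fun t => Ψ.symm ⟨Φ t, hsub (Φ t).2⟩
  have hΨ : ∀ t, (Ψ (h t) : Plane) = Φ t := fun t => by simp [h]
  have hc : Continuous h := by fun_prop
  have hr : (range h).OrdConnected := (isPreconnected_range hc).ordConnected
  have hsurj : ∀ t ∉ Ioo a b, t ∈ range h := by
    intro t ht
    have ht' : (Ψ t : Plane) ∈ γ := not_not.1 fun hn => ht ((hmem t).2 hn)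
    refine ⟨Φ.symm ⟨Ψ t, ht'⟩, ?_⟩
    simp [h]
  obtain ⟨s, hs⟩ := hr.out (hsurj a fun hn => lt_irrefl _ hn.1) (hsurj b fun hn => lt_irrefl _ hn.2)
    (Ioo_subset_Icc_self hm)
  exact (hmem (h s)).1 (hs ▸ hm) (hΨ s ▸ (Φ s).2)

theorem exists_isDetour {γ γ' : Set Plane} (hγ : IsTopLine γ) (hγ' : IsTopLine γ') (hne : γ ≠ γ')
    (hp : IsPortion γ (γ \ γ')) (hp' : IsPortion γ' (γ' \ γ)) (Φ : ℝ ≃ₜ γ) :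
    ∃ (ψ : ℝ → Plane) (a b : ℝ), range ψ = γ' ∧ IsDetour (fun t => (Φ t : Plane)) ψ a b := by
  have hns := hp'.not_subset hγ hγ' hne
  have hns' := hp.not_subset hγ' hγ hne.symm
  obtain ⟨Ψ⟩ := hγ'
  obtain ⟨a, b, hab⟩ := hp.2 Φ
  obtain ⟨a', b', hab'⟩ := hp'.2 Ψ
  have hmem : ∀ t, t ∈ Ioo a b ↔ (Φ t : Plane) ∉ γ' := by
    intro t
    rw [← hab]
    exact ⟨fun ht => ht.2, fun ht => ⟨(Φ t).2, ht⟩⟩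
  have hmem' : ∀ t, t ∈ Ioo a' b' ↔ (Ψ t : Plane) ∉ γ := by
    intro t
    rw [← hab']
    exact ⟨fun ht => ht.2, fun ht => ⟨(Ψ t).2, ht⟩⟩
  have hlt : a < b := by
    obtain ⟨z, hz, hz'⟩ := not_subset.1 hns
    have hm : Φ.symm ⟨z, hz⟩ ∈ Ioo a b := by
      rw [hmem, Φ.apply_symm_apply]
      exact hz'
    exact hm.1.trans hm.2
  have hlt' : a' < b' := by
    obtain ⟨z, hz, hz'⟩ := not_subset.1 hns'
    have hm : Ψ.symm ⟨z, hz⟩ ∈ Ioo a' b' := by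
      rw [hmem', Ψ.apply_symm_apply]
      exact hz'
    exact hm.1.trans hm.2
  have hin : ∀ t : ((Ioo a b)ᶜ : Set ℝ), (Φ t : Plane) ∈ γ' := fun t =>
    not_not.1 fun hn => t.2 ((hmem t).2 hn)
  classical
  let h : ℝ → ℝ := fun t => if ht : (Φ t : Plane) ∈ γ' then Ψ.symm ⟨Φ t, ht⟩ else 0
  have hΨ : ∀ t ∈ (Ioo a b)ᶜ, (Ψ (h t) : Plane) = Φ t := by
    intro t ht
    simp [h, hin ⟨t, ht⟩]
  have hc : ContinuousOn h (Ioo a b)ᶜ := by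
    rw [continuousOn_iff_continuous_domRestrict]
    have : (Ioo a b)ᶜ.domRestrict h = fun t : ((Ioo a b)ᶜ : Set ℝ) => Ψ.symm ⟨Φ t, hin t⟩ := by
      funext t
      simp [h, hin t]
    rw [this]
    fun_prop
  have hi : InjOn h (Ioo a b)ᶜ := by
    intro x hx y hy hxy
    exact Φ.injective (Subtype.ext ((hΨ x hx).symm.trans (hxy ▸ hΨ y hy)))
  have him : h '' (Ioo a b)ᶜ = (Ioo a' b')ᶜ := by
    ext s
    constructor
    · rintro ⟨t, ht, rfl⟩ hn
      exact (hmem' _).1 hn (hΨ t ht ▸ (Φ t).2)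
    · intro hs
      have hs' : (Ψ s : Plane) ∈ γ := not_not.1 fun hn => hs ((hmem' s).2 hn)
      have ht : Φ.symm ⟨Ψ s, hs'⟩ ∈ (Ioo a b)ᶜ := by
        rw [mem_compl_iff, hmem, Φ.apply_symm_apply, not_not]
        exact (Ψ s).2
      refine ⟨_, ht, Ψ.injective (Subtype.ext ?_)⟩
      rw [hΨ _ ht, Φ.apply_symm_apply]
  have hend := image_endpoints hlt hlt' hc hi him
  have hne' : h b - h a ≠ 0 := by
    rcases hend with hend | hend <;> rw [hend.1, hend.2] <;> linarith
  let u : ℝ → ℝ := fun t => h a + (t - a) / (b - a) * (h b - h a)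
  have hba : 0 < b - a := sub_pos.2 hlt
  have hu : Continuous u := by fun_prop
  have hua : u a = h a := by simp [u]
  have hub : u b = h b := by simp [u, hba.ne']
  have hui : u.Injective := by
    intro x y hxy
    have h1 := mul_right_cancel₀ hne' (add_left_cancel hxy)
    have h2 := (div_left_inj' hba.ne').1 h1
    linarith
  have hum : ∀ t ∈ Ioo a b, u t ∈ Ioo a' b' := by
    intro t ht
    have h0 : 0 < (t - a) / (b - a) := div_pos (sub_pos.2 ht.1) hba
    have h1 : (t - a) / (b - a) < 1 := (div_lt_one hba).2 (by linarith [ht.2])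
    rcases hend with hend | hend <;> simp only [u, hend.1, hend.2] <;> constructor <;> nlinarith
  have hus : ∀ s ∈ Ioo a' b', ∃ t ∈ Ioo a b, u t = s := by
    intro s hs
    have hsc : s ∈ u '' Icc a b := by
      rcases hend with hend | hend
      · exact intermediate_value_Icc hlt.le hu.continuousOn
          (by rw [hua, hub, hend.1, hend.2]; exact Ioo_subset_Icc_self hs)
      · exact intermediate_value_Icc' hlt.le hu.continuousOn
          (by rw [hua, hub, hend.1, hend.2]; exact Ioo_subset_Icc_self hs)
    obtain ⟨t, ht, rfl⟩ := hsc
    refine ⟨t, ⟨lt_of_le_of_ne ht.1 ?_, lt_of_le_of_ne ht.2 ?_⟩, rfl⟩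
    · rintro rfl
      rcases hend with hend | hend <;> rw [hua, hend.1] at hs
      exacts [lt_irrefl _ hs.1, lt_irrefl _ hs.2]
    · rintro rfl
      rcases hend with hend | hend <;> rw [hub, hend.2] at hs
      exacts [lt_irrefl _ hs.2, lt_irrefl _ hs.1]
  let ψ : ℝ → Plane := fun t => if t ∈ Ioo a b then Ψ (u t) else Φ t
  have hψ : ∀ t ∈ Ioo a b, ψ t = Ψ (u t) := fun t ht => if_pos ht
  have hψ' : ∀ t ∉ Ioo a b, ψ t = Φ t := fun t ht => if_neg ht
  have hψn : ∀ t ∈ Ioo a b, ψ t ∉ γ := fun t ht => by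
    rw [hψ t ht]
    exact (hmem' _).1 (hum t ht)
  have hrange : range ψ = γ' := by
    ext z
    constructor
    · rintro ⟨t, rfl⟩
      by_cases ht : t ∈ Ioo a b
      · rw [hψ t ht]
        exact (Ψ _).2
      · rw [hψ' t ht]
        exact hin ⟨t, ht⟩
    · intro hz
      by_cases hzγ : z ∈ γ
      · refine ⟨Φ.symm ⟨z, hzγ⟩, ?_⟩
        rw [hψ' _ (by rw [hmem, Φ.apply_symm_apply, not_not]; exact hz), Φ.apply_symm_apply]
      · obtain ⟨t, ht, hte⟩ := hus (Ψ.symm ⟨z, hz⟩)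
          (by rw [hmem', Ψ.apply_symm_apply]; exact hzγ)
        exact ⟨t, by rw [hψ t ht, hte, Ψ.apply_symm_apply]⟩
  refine ⟨ψ, a, b, hrange, ?_, ?_, ?_, ?_, hlt, hψ', ?_, ?_⟩
  · fun_prop
  · refine continuous_if ?_ (by fun_prop) (by fun_prop)
    intro t ht
    change t ∈ frontier (Ioo a b) at ht
    rw [frontier_Ioo hlt] at ht
    rcases ht with rfl | rfl
    · rw [hua, hΨ _ fun hn => lt_irrefl _ hn.1]
    · rw [hub, hΨ _ fun hn => lt_irrefl _ hn.2]
  · exact Subtype.val_injective.comp Φ.injective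
  · intro s t hst
    by_cases hs : s ∈ Ioo a b <;> by_cases ht : t ∈ Ioo a b
    · rw [hψ s hs, hψ t ht] at hst
      exact hui (Ψ.injective (Subtype.ext hst))
    · exact absurd (hst ▸ hψ' t ht ▸ (Φ t).2) (hψn s hs)
    · exact absurd (hst.symm ▸ hψ' s hs ▸ (Φ s).2) (hψn t ht)
    · rw [hψ' s hs, hψ' t ht] at hst
      exact Φ.injective (Subtype.ext hst)
  · intro t ht
    rw [hrange]
    exact (hmem t).1 ht
  · rintro t ht ⟨s, hs⟩
    exact hψn t ht (hs ▸ (Φ s).2)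

theorem IsPortion.ordConnected_notMem {γ γ' : Set Plane} (hγ : IsTopLine γ)
    (hp : IsPortion γ (γ \ γ')) {f : ℝ → Plane} (hf : Continuous f) (hi : f.Injective)
    (hr : range f = γ) : {t | f t ∉ γ'}.OrdConnected := by
  obtain ⟨Φ⟩ := hγ
  obtain ⟨a, b, hab⟩ := hp.2 Φ
  have hm : ∀ t, f t ∈ γ := fun t => hr ▸ mem_range_self t
  let h : ℝ → ℝ := fun t => Φ.symm ⟨f t, hm t⟩
  have hc : Continuous h := by fun_prop
  have hinj : h.Injective := fun x y hxy =>
    hi (congrArg Subtype.val (Φ.symm.injective hxy))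
  have heq : {t | f t ∉ γ'} = h ⁻¹' Ioo a b := by
    ext t
    rw [mem_preimage, ← hab]
    simp [h]
  rw [heq]
  rcases hc.strictMono_of_inj hinj with hmono | hanti
  · exact ordConnected_Ioo.preimage_mono hmono.monotone
  · exact ordConnected_Ioo.preimage_anti hanti.antitone

theorem IsPreconnected.union_of_closure_inter {X : Type*} [TopologicalSpace X] {s t : Set X}
    (hs : IsPreconnected s) (ht : IsPreconnected t) {x : X} (hxs : x ∈ closure s) (hxt : x ∈ t) :
    IsPreconnected (s ∪ t) := by
  have h : IsPreconnected (insert x s) :=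
    hs.subset_closure (subset_insert x s) (insert_subset hxs subset_closure)
  convert h.union x (mem_insert x s) hxt ht using 1
  rw [insert_union, insert_eq_of_mem (mem_union_right s hxt)]

/-- The part of the cycle `φ '' Icc a b ∪ ψ '' Icc a b` of a detour which is complementary to the
arc `φ '' Icc m M`. -/
def detourArm (φ ψ : ℝ → Plane) (a b m M : ℝ) : Set Plane :=
  ψ '' Ioo a b ∪ φ '' Icc a m ∪ φ '' Icc M b

namespace IsDetour

section Arm

variable {φ ψ : ℝ → Plane} {a b m M : ℝ}

theorem source_mem_closure (h : IsDetour φ ψ a b) : φ a ∈ closure (ψ '' Ioo a b) := by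
  rw [closure_image_Ioo h.continuous_right h.lt]
  exact ⟨a, left_mem_Icc.2 h.lt.le, h.eq_source⟩

theorem target_mem_closure (h : IsDetour φ ψ a b) : φ b ∈ closure (ψ '' Ioo a b) := by
  rw [closure_image_Ioo h.continuous_right h.lt]
  exact ⟨b, right_mem_Icc.2 h.lt.le, h.eq_target⟩

theorem image_Icc_subset_arm (h : IsDetour φ ψ a b) (ham : a ≤ m) (hMb : M ≤ b) :
    ψ '' Icc a b ⊆ detourArm φ ψ a b m M := by
  rintro _ ⟨t, ht, rfl⟩
  rcases eq_or_lt_of_le ht.1 with rfl | h1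
  · exact Or.inl (Or.inr ⟨a, left_mem_Icc.2 ham, h.eq_source.symm⟩)
  rcases eq_or_lt_of_le ht.2 with rfl | h2
  · exact Or.inr ⟨t, right_mem_Icc.2 hMb, h.eq_target.symm⟩
  exact Or.inl (Or.inl ⟨t, ⟨h1, h2⟩, rfl⟩)

theorem isClosed_arm (h : IsDetour φ ψ a b) (ham : a ≤ m) (hMb : M ≤ b) :
    IsClosed (detourArm φ ψ a b m M) := by
  have heq : detourArm φ ψ a b m M = ψ '' Icc a b ∪ φ '' Icc a m ∪ φ '' Icc M b := by
    refine Subset.antisymm ?_ (union_subset (union_subset (h.image_Icc_subset_arm ham hMb) ?_) ?_)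
    · exact union_subset_union_left _
        (union_subset_union_left _ (image_mono Ioo_subset_Icc_self))
    · exact subset_union_right.trans subset_union_left
    · exact subset_union_right
  rw [heq]
  exact (((isCompact_Icc.image h.continuous_right).union
    (isCompact_Icc.image h.continuous_left)).union
    (isCompact_Icc.image h.continuous_left)).isClosed

theorem lineJ_eq_arm (h : IsDetour φ ψ a b) (ham : a ≤ m) (hmM : m ≤ M) (hMb : M ≤ b) :
    lineJ (range φ) (range ψ) = φ '' Icc m M ∪ detourArm φ ψ a b m M := by
  rw [h.lineJ_eq]
  refine Subset.antisymm (union_subset ?_ ?_)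
    (union_subset ?_ (union_subset (union_subset ?_ ?_) ?_))
  · rintro _ ⟨t, ht, rfl⟩
    rcases le_total t m with h1 | h1
    · exact Or.inr (Or.inl (Or.inr ⟨t, ⟨ht.1, h1⟩, rfl⟩))
    rcases le_total t M with h2 | h2
    · exact Or.inl ⟨t, ⟨h1, h2⟩, rfl⟩
    · exact Or.inr (Or.inr ⟨t, ⟨h2, ht.2⟩, rfl⟩)
  · exact (h.image_Icc_subset_arm ham hMb).trans subset_union_right
  · exact (image_mono (Icc_subset_Icc ham hMb)).trans subset_union_left
  · exact (image_mono Ioo_subset_Icc_self).trans subset_union_right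
  · exact (image_mono (Icc_subset_Icc_right (hmM.trans hMb))).trans subset_union_left
  · exact (image_mono (Icc_subset_Icc_left (ham.trans hmM))).trans subset_union_left

theorem isPreconnected_image_Ioo (h : IsDetour φ ψ a b) : IsPreconnected (ψ '' Ioo a b) :=
  isPreconnected_Ioo.image ψ h.continuous_right.continuousOn

theorem isPreconnected_arm (h : IsDetour φ ψ a b) (ham : a ≤ m) (hMb : M ≤ b) :
    IsPreconnected (detourArm φ ψ a b m M) :=
  (h.isPreconnected_image_Ioo.union_of_closure_inter
    (isPreconnected_Icc.image φ h.continuous_left.continuousOn) h.source_mem_closure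
    ⟨a, left_mem_Icc.2 ham, rfl⟩).union_of_closure_inter
    (isPreconnected_Icc.image φ h.continuous_left.continuousOn)
    (closure_mono subset_union_left h.target_mem_closure) ⟨b, right_mem_Icc.2 hMb, rfl⟩

theorem arm_diff (h : IsDetour φ ψ a b) (hmM : m < M) :
    detourArm φ ψ a b m M \ {φ m, φ M} = ψ '' Ioo a b ∪ φ '' Ico a m ∪ φ '' Ioc M b := by
  have hi := h.injective_left
  ext z
  constructor
  · rintro ⟨(hz | ⟨t, ht, rfl⟩) | ⟨t, ht, rfl⟩, hn⟩
    · exact Or.inl (Or.inl hz)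
    · refine Or.inl (Or.inr ⟨t, ⟨ht.1, lt_of_le_of_ne ht.2 ?_⟩, rfl⟩)
      rintro rfl
      exact hn (Or.inl rfl)
    · refine Or.inr ⟨t, ⟨lt_of_le_of_ne ht.1 ?_, ht.2⟩, rfl⟩
      rintro rfl
      exact hn (Or.inr rfl)
  · rintro ((⟨t, ht, rfl⟩ | ⟨t, ht, rfl⟩) | ⟨t, ht, rfl⟩)
    · refine ⟨Or.inl (Or.inl ⟨t, ht, rfl⟩), ?_⟩
      rintro (hn | hn)
      · exact h.right_notMem t ht ⟨m, hn.symm⟩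
      · exact h.right_notMem t ht ⟨M, hn.symm⟩
    · refine ⟨Or.inl (Or.inr ⟨t, Ico_subset_Icc_self ht, rfl⟩), ?_⟩
      rintro (hn | hn)
      · exact ht.2.ne (hi hn)
      · exact (ht.2.trans hmM).ne (hi hn)
    · refine ⟨Or.inr ⟨t, Ioc_subset_Icc_self ht, rfl⟩, ?_⟩
      rintro (hn | hn)
      · exact (hmM.trans ht.1).ne' (hi hn)
      · exact ht.1.ne' (hi hn)

theorem isPreconnected_arm_diff (h : IsDetour φ ψ a b) (ham : a ≤ m) (hmM : m < M) (hMb : M ≤ b) :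
    IsPreconnected (detourArm φ ψ a b m M \ {φ m, φ M}) := by
  rw [h.arm_diff hmM]
  have hl : IsPreconnected (ψ '' Ioo a b ∪ φ '' Ico a m) := by
    rcases eq_or_lt_of_le ham with rfl | ham
    · simpa using h.isPreconnected_image_Ioo
    · exact h.isPreconnected_image_Ioo.union_of_closure_inter
        (isPreconnected_Ico.image φ h.continuous_left.continuousOn) h.source_mem_closure
        ⟨a, left_mem_Ico.2 ham, rfl⟩
  rcases eq_or_lt_of_le hMb with rfl | hMb
  · simpa using hl
  · exact hl.union_of_closure_inter (isPreconnected_Ioc.image φ h.continuous_left.continuousOn)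
      (closure_mono subset_union_left h.target_mem_closure) ⟨b, right_mem_Ioc.2 hMb, rfl⟩

theorem nonempty_arm_diff (h : IsDetour φ ψ a b) (hmM : m < M) :
    (detourArm φ ψ a b m M \ {φ m, φ M}).Nonempty := by
  rw [h.arm_diff hmM]
  exact (((nonempty_Ioo.2 h.lt).image ψ).mono subset_union_left).mono subset_union_left

theorem inter_arm (h : IsDetour φ ψ a b) (ham : a ≤ m) (hmM : m < M) (hMb : M ≤ b) :
    φ '' Icc m M ∩ detourArm φ ψ a b m M = {φ m, φ M} := by
  have hi := h.injective_left
  ext z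
  constructor
  · rintro ⟨⟨t, ht, rfl⟩, (⟨s, hs, hst⟩ | ⟨s, hs, hst⟩) | ⟨s, hs, hst⟩⟩
    · exact absurd ⟨t, hst.symm⟩ (h.right_notMem s hs)
    · obtain rfl := hi hst
      exact Or.inl (congrArg φ (le_antisymm hs.2 ht.1))
    · obtain rfl := hi hst
      exact Or.inr (congrArg φ (le_antisymm ht.2 hs.1))
  · rintro (rfl | rfl)
    · exact ⟨⟨m, left_mem_Icc.2 hmM.le, rfl⟩, Or.inl (Or.inr ⟨m, right_mem_Icc.2 ham, rfl⟩)⟩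
    · exact ⟨⟨M, right_mem_Icc.2 hmM.le, rfl⟩, Or.inr ⟨M, left_mem_Icc.2 hMb, rfl⟩⟩

end Arm

variable {φ ψ χ : ℝ → Plane} {a b c d m M : ℝ}

theorem inter_subset_of_lt (h : IsDetour φ ψ a b) (h' : IsDetour φ χ c d)
    (ho : {t | ψ t ∉ range χ}.OrdConnected) (hac : a < c) (hbd : b < d) :
    range ψ ∩ range χ ⊆ range φ := by
  rintro _ ⟨⟨t, rfl⟩, ht⟩
  by_contra hn
  have htab : t ∈ Ioo a b := not_not.1 fun hn' => hn (h.right_mem_iff.2 hn')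
  obtain ⟨e, he, hed⟩ := exists_between (max_lt hbd h'.lt)
  have hbe : b < e := (le_max_left _ _).trans_lt he
  have hψe : ψ e ∉ range χ := by
    rw [h.eq_off e fun hn' => lt_asymm hbe hn'.2]
    exact h'.left_notMem e ⟨(le_max_right _ _).trans_lt he, hed⟩
  have hle : ∀ u ≤ t, ψ u ∈ range χ := by
    intro u hu
    by_contra hu'
    exact ho.out hu' hψe ⟨hu, (htab.2.trans hbe).le⟩ ht
  have hsub : ψ '' Ioo a t ⊆ χ '' Icc c d := by
    refine Subset.trans ?_ (image_mono Ioo_subset_Icc_self)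
    rw [← h'.range_diff_right]
    rintro _ ⟨u, hu, rfl⟩
    exact ⟨hle u hu.2.le, h.right_notMem u ⟨hu.1, hu.2.trans htab.2⟩⟩
  have hcl := closure_minimal hsub (isCompact_Icc.image h'.continuous_right).isClosed
  rw [closure_image_Ioo h.continuous_right htab.1] at hcl
  obtain ⟨s, hs, hsa⟩ := hcl ⟨a, left_mem_Icc.2 htab.1.le, rfl⟩
  rw [h.eq_source, ← h'.eq_off a fun hn' => lt_asymm hac hn'.1] at hsa
  rw [h'.injective_right hsa] at hs
  exact not_le.2 hac hs.1

/-- Among a curve and two detours of it, one contains the intersection of the others. -/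
theorem inter_subset_or (h : IsDetour φ ψ a b) (h' : IsDetour φ χ c d)
    (ho : {t | ψ t ∉ range χ}.OrdConnected) (ho' : {t | χ t ∉ range ψ}.OrdConnected) :
    range ψ ∩ range χ ⊆ range φ ∨ range φ ∩ range χ ⊆ range ψ ∨ range φ ∩ range ψ ⊆ range χ := by
  by_contra! hn
  obtain ⟨hn₁, hn₂, hn₃⟩ := hn
  obtain ⟨_, ⟨⟨t, rfl⟩, htχ⟩, htψ⟩ := Set.not_subset.1 hn₂
  obtain ⟨_, ⟨⟨s, rfl⟩, hsψ⟩, hsχ⟩ := Set.not_subset.1 hn₃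
  rw [h'.left_mem_iff, mem_Ioo, not_and_or, not_lt, not_lt] at htχ
  rw [h.left_mem_iff, mem_Ioo, not_and_or, not_lt, not_lt] at hsψ
  rw [h.left_mem_iff, not_not] at htψ
  rw [h'.left_mem_iff, not_not] at hsχ
  obtain ⟨hat, htb⟩ := htψ
  obtain ⟨hcs, hsd⟩ := hsχ
  rcases htχ with htc | htd
  · refine hn₁ (h.inter_subset_of_lt h' ho (by linarith) ?_)
    rcases hsψ with hs | hs <;> linarith
  · rw [inter_comm] at hn₁
    refine hn₁ (h'.inter_subset_of_lt h ho' ?_ (by linarith))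
    rcases hsψ with hs | hs <;> linarith

theorem lt_of_inter_subset (h : IsDetour φ ψ a b) (h' : IsDetour φ χ c d)
    (ho : {t | ψ t ∉ range χ}.OrdConnected) (hsub : range ψ ∩ range χ ⊆ range φ) : c < b := by
  by_contra! hbc
  obtain ⟨s, hs⟩ := nonempty_Ioo.2 h.lt
  obtain ⟨t, ht⟩ := nonempty_Ioo.2 h'.lt
  have hψs : ψ s ∉ range χ := fun hn => h.right_notMem s hs (hsub ⟨mem_range_self s, hn⟩)
  have hψt : ψ t ∉ range χ := by
    rw [h.eq_off t fun hn => not_lt.2 hbc (ht.1.trans hn.2)]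
    exact h'.left_notMem t ht
  refine ho.out hψs hψt ⟨hs.2.le, hbc.trans ht.1.le⟩ ?_
  rw [h.eq_target]
  exact ⟨b, h'.eq_off b fun hn => not_lt.2 hbc hn.1⟩

theorem range_diff_subset_arm (h : IsDetour φ ψ a b) (h' : IsDetour φ χ c d)
    (ham : a ≤ m) (hMb : M ≤ b) :
    range ψ \ range χ ⊆ detourArm φ ψ a b m M ∪ detourArm φ χ c d m M := by
  rintro _ ⟨⟨t, rfl⟩, ht⟩
  by_cases htab : t ∈ Ioo a b
  · exact Or.inl (Or.inl (Or.inl ⟨t, htab, rfl⟩))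
  rw [h.eq_off t htab] at ht ⊢
  rw [h'.left_mem_iff, not_not] at ht
  rw [mem_Ioo, not_and_or, not_lt, not_lt] at htab
  rcases htab with hta | hbt
  · exact Or.inr (Or.inl (Or.inr ⟨t, ⟨ht.1.le, hta.trans ham⟩, rfl⟩))
  · exact Or.inr (Or.inr ⟨t, ⟨hMb.trans hbt, ht.2.le⟩, rfl⟩)

theorem arm_subset_lineJ (h : IsDetour φ ψ a b) (h' : IsDetour φ χ c d)
    (hsub : range ψ ∩ range χ ⊆ range φ) (hm : m = max a c) (hM : M = min b d) (hmM : m < M) :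
    detourArm φ ψ a b m M ⊆ lineJ (range ψ) (range χ) := by
  have hψ : ψ '' Ioo a b ⊆ symmDiff (range ψ) (range χ) := by
    rintro _ ⟨t, ht, rfl⟩
    exact Or.inl ⟨mem_range_self t,
      fun hn => h.right_notMem t ht (hsub ⟨mem_range_self t, hn⟩)⟩
  have ham : a ≤ m := hm ▸ le_max_left a c
  have hMb : M ≤ b := hM ▸ min_le_left b d
  refine union_subset (union_subset (hψ.trans subset_closure) ?_) ?_
  · rcases eq_or_lt_of_le ham with rfl | ham
    · rw [Icc_self, image_singleton, singleton_subset_iff]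
      exact closure_mono hψ h.source_mem_closure
    · rw [← closure_image_Ioo h.continuous_left ham]
      refine closure_mono ?_
      rintro _ ⟨t, ht, rfl⟩
      have htc : t < c := (lt_max_iff.1 (hm ▸ ht.2)).resolve_left ht.1.not_gt
      exact Or.inr ⟨⟨t, h'.eq_off t fun hn => lt_asymm htc hn.1⟩,
        h.left_notMem t ⟨ht.1, (ht.2.trans hmM).trans_le hMb⟩⟩
  · rcases eq_or_lt_of_le hMb with rfl | hMb
    · rw [Icc_self, image_singleton, singleton_subset_iff]
      exact closure_mono hψ h.target_mem_closure
    · rw [← closure_image_Ioo h.continuous_left hMb]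
      refine closure_mono ?_
      rintro _ ⟨t, ht, rfl⟩
      have htd : d < t := (min_lt_iff.1 (hM ▸ ht.1)).resolve_left ht.2.not_gt
      exact Or.inr ⟨⟨t, h'.eq_off t fun hn => lt_asymm htd hn.2⟩,
        h.left_notMem t ⟨ham.trans_lt (hmM.trans ht.1), ht.2⟩⟩

theorem lineJ_eq_arm_union_arm (h : IsDetour φ ψ a b) (h' : IsDetour φ χ c d)
    (hsub : range ψ ∩ range χ ⊆ range φ) (hm : m = max a c) (hM : M = min b d) (hmM : m < M) :
    lineJ (range ψ) (range χ) = detourArm φ ψ a b m M ∪ detourArm φ χ c d m M := by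
  have ham : a ≤ m := hm ▸ le_max_left a c
  have hcm : c ≤ m := hm ▸ le_max_right a c
  have hMb : M ≤ b := hM ▸ min_le_left b d
  have hMd : M ≤ d := hM ▸ min_le_right b d
  refine Subset.antisymm (closure_minimal (union_subset ?_ ?_)
    ((h.isClosed_arm ham hMb).union (h'.isClosed_arm hcm hMd))) (union_subset ?_ ?_)
  · exact h.range_diff_subset_arm h' ham hMb
  · exact (h'.range_diff_subset_arm h hcm hMd).trans (union_comm _ _).subset
  · exact h.arm_subset_lineJ h' hsub hm hM hmM
  · rw [lineJ, symmDiff_comm]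
    exact h'.arm_subset_lineJ h (inter_comm (range ψ) (range χ) ▸ hsub)
      (hm.trans (max_comm a c)) (hM.trans (min_comm b d)) hmM

theorem arm_inter_arm (h : IsDetour φ ψ a b) (h' : IsDetour φ χ c d)
    (hsub : range ψ ∩ range χ ⊆ range φ) (hm : m = max a c) (hM : M = min b d) (hmM : m < M) :
    detourArm φ ψ a b m M ∩ detourArm φ χ c d m M = {φ m, φ M} := by
  have hi := h.injective_left
  have ham : a ≤ m := hm ▸ le_max_left a c
  have hcm : c ≤ m := hm ▸ le_max_right a c
  have hMb : M ≤ b := hM ▸ min_le_left b d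
  have hMd : M ≤ d := hM ▸ min_le_right b d
  ext z
  constructor
  · rintro ⟨hz, hz'⟩
    have hzφ : z ∈ range φ := by
      rcases hz with (⟨t, -, rfl⟩ | hz) | hz
      · rcases hz' with (⟨s, -, hs⟩ | hz') | hz'
        · exact hsub ⟨mem_range_self t, hs ▸ mem_range_self s⟩
        · exact image_subset_range _ _ hz'
        · exact image_subset_range _ _ hz'
      · exact image_subset_range _ _ hz
      · exact image_subset_range _ _ hz
    obtain ⟨t, rfl⟩ := hzφ
    have ht : t ∈ Icc a m ∪ Icc M b := by
      rcases hz with (⟨s, hs, hst⟩ | ⟨s, hs, hst⟩) | ⟨s, hs, hst⟩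
      · exact absurd ⟨t, hst.symm⟩ (h.right_notMem s hs)
      · exact Or.inl (hi hst ▸ hs)
      · exact Or.inr (hi hst ▸ hs)
    have ht' : t ∈ Icc c m ∪ Icc M d := by
      rcases hz' with (⟨s, hs, hst⟩ | ⟨s, hs, hst⟩) | ⟨s, hs, hst⟩
      · exact absurd ⟨t, hst.symm⟩ (h'.right_notMem s hs)
      · exact Or.inl (hi hst ▸ hs)
      · exact Or.inr (hi hst ▸ hs)
    rcases ht with ht | ht <;> rcases ht' with ht' | ht'
    · exact Or.inl (congrArg φ (le_antisymm ht.2 (hm ▸ max_le ht.1 ht'.1)))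
    · exact absurd (ht'.1.trans ht.2) (not_le.2 hmM)
    · exact absurd (ht.1.trans ht'.2) (not_le.2 hmM)
    · exact Or.inr (congrArg φ (le_antisymm (hM ▸ le_min ht.2 ht'.2) ht.1))
  · rintro (rfl | rfl)
    · exact ⟨Or.inl (Or.inr ⟨m, right_mem_Icc.2 ham, rfl⟩),
        Or.inl (Or.inr ⟨m, right_mem_Icc.2 hcm, rfl⟩)⟩
    · exact ⟨Or.inr ⟨M, left_mem_Icc.2 hMb, rfl⟩, Or.inr ⟨M, left_mem_Icc.2 hMd, rfl⟩⟩

/-- A curve and two detours of it whose intersection is contained in the curve form a theta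
curve. -/
theorem exists_isTheta (h : IsDetour φ ψ a b) (h' : IsDetour φ χ c d)
    (ho : {t | ψ t ∉ range χ}.OrdConnected) (ho' : {t | χ t ∉ range ψ}.OrdConnected)
    (hsub : range ψ ∩ range χ ⊆ range φ) (hJ : IsJordanLike (lineJ (range ψ) (range χ))) :
    ∃ A₁ A₂ A₃ p q, IsTheta A₁ A₂ A₃ p q ∧ lineJ (range φ) (range ψ) = A₁ ∪ A₂ ∧
      lineJ (range φ) (range χ) = A₁ ∪ A₃ ∧ lineJ (range ψ) (range χ) = A₂ ∪ A₃ := by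
  obtain ⟨m, hm⟩ : ∃ m, m = max a c := ⟨_, rfl⟩
  obtain ⟨M, hM⟩ : ∃ M, M = min b d := ⟨_, rfl⟩
  have hmM : m < M := by
    rw [hm, hM, max_lt_iff, lt_min_iff, lt_min_iff]
    exact ⟨⟨h.lt, h'.lt_of_inter_subset h ho' (inter_comm (range ψ) (range χ) ▸ hsub)⟩,
      h.lt_of_inter_subset h' ho hsub, h'.lt⟩
  have ham : a ≤ m := hm ▸ le_max_left a c
  have hcm : c ≤ m := hm ▸ le_max_right a c
  have hMb : M ≤ b := hM ▸ min_le_left b d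
  have hMd : M ≤ d := hM ▸ min_le_right b d
  have e₁ := h.lineJ_eq_arm_union_arm h' hsub hm hM hmM
  have e₂ := h'.lineJ_eq_arm hcm hmM.le hMd
  have e₃ := h.lineJ_eq_arm ham hmM.le hMb
  have hφ : φ '' Icc m M \ {φ m, φ M} = φ '' Ioo m M := by
    rw [← Icc_sdiff_both, image_sdiff h.injective_left, image_pair]
  refine ⟨φ '' Icc m M, detourArm φ ψ a b m M, detourArm φ χ c d m M, φ m, φ M, ?_, e₃, e₂, e₁⟩
  exact {
    jordan₁ := e₁ ▸ hJ
    jordan₂ := e₂ ▸ h'.isJordanLike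
    jordan₃ := e₃ ▸ h.isJordanLike
    conn₁ := isPreconnected_Icc.image φ h.continuous_left.continuousOn
    conn₂ := h.isPreconnected_arm ham hMb
    conn₃ := h'.isPreconnected_arm hcm hMd
    inter₁ := h.arm_inter_arm h' hsub hm hM hmM
    inter₂ := h'.inter_arm hcm hmM hMd
    inter₃ := h.inter_arm ham hmM hMb
    conn_diff₁ := hφ ▸ isPreconnected_Ioo.image φ h.continuous_left.continuousOn
    conn_diff₂ := h.isPreconnected_arm_diff ham hmM hMb
    conn_diff₃ := h'.isPreconnected_arm_diff hcm hmM hMd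
    nonempty_diff₁ := hφ ▸ (nonempty_Ioo.2 hmM).image φ
    nonempty_diff₂ := h.nonempty_arm_diff hmM
    nonempty_diff₃ := h'.nonempty_arm_diff hmM }

end IsDetour

theorem lineJ_comm (γ γ' : Set Plane) : lineJ γ γ' = lineJ γ' γ := by
  rw [lineJ, lineJ, symmDiff_comm]

theorem exists_isTheta_of_lines {Γ : Set (Set Plane)} (hline : ∀ γ ∈ Γ, IsTopLine γ)
    (hport : ∀ γ ∈ Γ, ∀ γ' ∈ Γ, γ ≠ γ' → IsPortion γ (γ \ γ'))
    {σ σ' σ'' : Set Plane} (hσ : σ ∈ Γ) (hσ' : σ' ∈ Γ) (hσ'' : σ'' ∈ Γ)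
    (h1 : σ ≠ σ') (h2 : σ ≠ σ'') (h3 : σ' ≠ σ'') :
    ∃ A A' A'' p q, IsTheta A A' A'' p q ∧ lineJ σ σ' = A ∪ A' ∧ lineJ σ σ'' = A ∪ A'' ∧
      lineJ σ' σ'' = A' ∪ A'' := by
  have key : ∀ {τ τ' τ'' : Set Plane}, τ ∈ Γ → τ' ∈ Γ → τ'' ∈ Γ → τ ≠ τ' → τ ≠ τ'' → τ' ≠ τ'' →
      ∃ (φ ψ χ : ℝ → Plane) (a b c d : ℝ), range φ = τ ∧ range ψ = τ' ∧ range χ = τ'' ∧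
        IsDetour φ ψ a b ∧ IsDetour φ χ c d ∧ {t | ψ t ∉ range χ}.OrdConnected ∧
        {t | χ t ∉ range ψ}.OrdConnected := by
    intro τ τ' τ'' hτ hτ' hτ'' n1 n2 n3
    obtain ⟨Φ⟩ := hline τ hτ
    obtain ⟨ψ, a, b, rfl, h⟩ := exists_isDetour (hline τ hτ) (hline τ' hτ') n1
      (hport τ hτ τ' hτ' n1) (hport τ' hτ' τ hτ n1.symm) Φ
    obtain ⟨χ, c, d, rfl, h'⟩ := exists_isDetour (hline τ hτ) (hline τ'' hτ'') n2
      (hport τ hτ τ'' hτ'' n2) (hport τ'' hτ'' τ hτ n2.symm) Φ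
    refine ⟨fun t => Φ t, ψ, χ, a, b, c, d, ?_, rfl, rfl, h, h', ?_, ?_⟩
    · exact (Φ.surjective.range_comp Subtype.val).trans Subtype.range_coe
    · exact (hport _ hτ' _ hτ'' n3).ordConnected_notMem (hline _ hτ') h.continuous_right
        h.injective_right rfl
    · exact (hport _ hτ'' _ hτ' n3.symm).ordConnected_notMem (hline _ hτ'') h'.continuous_right
        h'.injective_right rfl
  have hJ : ∀ {τ τ' : Set Plane}, τ ∈ Γ → τ' ∈ Γ → τ ≠ τ' → IsJordanLike (lineJ τ τ') := by
    intro τ τ' hτ hτ' n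
    obtain ⟨Φ⟩ := hline τ hτ
    obtain ⟨ψ, a, b, rfl, h⟩ := exists_isDetour (hline τ hτ) (hline τ' hτ') n
      (hport τ hτ τ' hτ' n) (hport τ' hτ' τ hτ n.symm) Φ
    have hr : range (fun t => (Φ t : Plane)) = τ :=
      (Φ.surjective.range_comp Subtype.val).trans Subtype.range_coe
    exact hr ▸ h.isJordanLike
  have theta : ∀ {τ τ' τ'' : Set Plane}, τ ∈ Γ → τ' ∈ Γ → τ'' ∈ Γ → τ ≠ τ' → τ ≠ τ'' → τ' ≠ τ'' →
      τ' ∩ τ'' ⊆ τ → ∃ A A' A'' p q, IsTheta A A' A'' p q ∧ lineJ τ τ' = A ∪ A' ∧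
        lineJ τ τ'' = A ∪ A'' ∧ lineJ τ' τ'' = A' ∪ A'' := by
    intro τ τ' τ'' hτ hτ' hτ'' n1 n2 n3 hsub
    obtain ⟨φ, ψ, χ, a, b, c, d, rfl, rfl, rfl, h, h', ho, ho'⟩ := key hτ hτ' hτ'' n1 n2 n3
    exact h.exists_isTheta h' ho ho' hsub (hJ hτ' hτ'' n3)
  have hsub : σ' ∩ σ'' ⊆ σ ∨ σ ∩ σ'' ⊆ σ' ∨ σ ∩ σ' ⊆ σ'' := by
    obtain ⟨φ, ψ, χ, a, b, c, d, rfl, rfl, rfl, h, h', ho, ho'⟩ := key hσ hσ' hσ'' h1 h2 h3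
    exact h.inter_subset_or h' ho ho'
  rcases hsub with hsub | hsub | hsub
  · exact theta hσ hσ' hσ'' h1 h2 h3 hsub
  · obtain ⟨A', A, A'', p, q, hA, e₁, e₂, e₃⟩ := theta hσ' hσ hσ'' h1.symm h3 h2 hsub
    exact ⟨A, A', A'', p, q, hA.swap₁₂, by rw [lineJ_comm, e₁, union_comm], e₃, e₂⟩
  · obtain ⟨A'', A, A', p, q, hA, e₁, e₂, e₃⟩ := theta hσ'' hσ hσ' h2.symm h3.symm h1 hsub
    exact ⟨A, A', A'', p, q, hA.swap₁₂.swap₂₃, e₃, by rw [lineJ_comm, e₁, union_comm],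
      by rw [lineJ_comm, e₂, union_comm]⟩

theorem stmt13 (Γ : Set (Set Plane)) (hline : ∀ γ ∈ Γ, IsTopLine γ)
    (hport : ∀ γ ∈ Γ, ∀ γ' ∈ Γ, γ ≠ γ' → IsPortion γ (γ \ γ'))
    (σ σ' σ'' : Set Plane) (hσ : σ ∈ Γ) (hσ' : σ' ∈ Γ) (hσ'' : σ'' ∈ Γ)
    (h1 : σ ≠ σ') (h2 : σ ≠ σ'') (h3 : σ' ≠ σ'') :
    (Between σ' σ'' σ ∧ ¬ Between σ σ'' σ' ∧ ¬ Between σ σ' σ'') ∨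
    (¬ Between σ' σ'' σ ∧ Between σ σ'' σ' ∧ ¬ Between σ σ' σ'') ∨
    (¬ Between σ' σ'' σ ∧ ¬ Between σ σ'' σ' ∧ Between σ σ' σ'') := by
  obtain ⟨A, A', A'', p, q, hA, e₁, e₂, e₃⟩ :=
    exists_isTheta_of_lines hline hport hσ hσ' hσ'' h1 h2 h3
  refine hA.exactly_one ?_ ?_ ?_
  · rw [Between, lineJ_comm σ' σ, e₁, e₃]
    exact hA.subset_closure_intRegion_iff
  · rw [Between, e₁, e₂, union_comm A A']
    exact hA.swap₁₂.subset_closure_intRegion_iff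
  · rw [Between, e₁, e₂, union_comm A A'']
    exact hA.swap₂₃.swap₁₂.subset_closure_intRegion_iff
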